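/- arXiv:1403.0476 — 2 statements merged into one kernel-verified Lean document; each statement's English description precedes it below -/
import Mathlib

section
/- Let Γ be a valued constraint language over a finite set D that contains every unary cost function D → ℚ ∪ {∞}, and suppose Pol⁺(Γ) contains an idempotent cyclic operation. Then Pol⁺(Γ) contains a majority operation, i.e., a ternary operation m with m(x,x,y) = m(x,y,x) = m(y,x,x) = x for all x, y ∈ D. -/
/-! Basic framework for Valued Constraint Satisfaction Problems (VCSP):
operations, clones, weightings, weighted clones, cost functions,
(weighted/fractional) polymorphisms, expressibility and weighted relational clones. -/

/-- A `k`-ary operation on `D`. -/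
abbrev Op (D : Type) (k : ℕ) : Type := (Fin k → D) → D

/-- The `i`-th `k`-ary projection on `D`. -/
def proj (D : Type) {k : ℕ} (i : Fin k) : Op D k := fun x => x i

/-- An operation is a projection. -/
def IsProj {D : Type} {k : ℕ} (f : Op D k) : Prop := ∃ i : Fin k, f = proj D i

/-- Superposition `f[g₁,…,g_k]` of a `k`-ary operation with `k` many `l`-ary operations. -/
def superposeOp {D : Type} {k l : ℕ} (f : Op D k) (g : Fin k → Op D l) : Op D l :=
  fun x => f fun i => g i x

/-- A clone of operations on `D`: contains all projections and is closed under superposition. -/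
structure IsClone {D : Type} (C : ∀ k, Set (Op D k)) : Prop where
  proj_mem : ∀ (k : ℕ) (i : Fin k), proj D i ∈ C k
  superpose_mem : ∀ (k l : ℕ) (f : Op D k) (g : Fin k → Op D l),
    f ∈ C k → (∀ i, g i ∈ C l) → superposeOp f g ∈ C l

/-- A `k`-ary weighting of the clone `C`: a rational-valued function on `k`-ary operations,
vanishing outside `C`, summing to `0`, and negative only on projections. -/
structure IsWeighting {D : Type} [Fintype D] [DecidableEq D] (C : ∀ k, Set (Op D k))
    {k : ℕ} (ω : Op D k → ℚ) : Prop where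
  support_mem : ∀ f : Op D k, ω f ≠ 0 → f ∈ C k
  sum_zero : ∑ f : Op D k, ω f = 0
  neg_imp_proj : ∀ f : Op D k, ω f < 0 → IsProj f

/-- Superposition of a `k`-ary weighting with `k` many `l`-ary operations. -/
def wSuperpose {D : Type} [Fintype D] [DecidableEq D] {k l : ℕ}
    (ω : Op D k → ℚ) (g : Fin k → Op D l) : Op D l → ℚ :=
  fun f' => ∑ f ∈ Finset.univ.filter (fun f : Op D k => superposeOp f g = f'), ω f

/-- A weighted clone over the clone `C`: a nonempty family of weightings of `C` closed under
non-negative scaling, addition of weightings of equal arity and proper superposition. -/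
structure IsWeightedClone {D : Type} [Fintype D] [DecidableEq D]
    (C : ∀ k, Set (Op D k)) (W : ∀ k, Set (Op D k → ℚ)) : Prop where
  clone : IsClone C
  weighting : ∀ (k : ℕ), ∀ ω ∈ W k, IsWeighting C ω
  nonempty : ∃ k, (W k).Nonempty
  scale_mem : ∀ (k : ℕ) (c : ℚ), 0 ≤ c → ∀ ω ∈ W k, (fun f => c * ω f) ∈ W k
  add_mem : ∀ (k : ℕ), ∀ ω₁ ∈ W k, ∀ ω₂ ∈ W k, (fun f => ω₁ f + ω₂ f) ∈ W k
  superpose_mem : ∀ (k l : ℕ), ∀ ω ∈ W k, ∀ g : Fin k → Op D l,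
    (∀ i, g i ∈ C l) → IsWeighting C (wSuperpose ω g) → wSuperpose ω g ∈ W l

/-- The positive clone of a family of weightings: all projections together with all operations
receiving positive weight from some weighting in the family. -/
def posClone {D : Type} [Fintype D] [DecidableEq D] (W : ∀ k, Set (Op D k → ℚ)) :
    ∀ k, Set (Op D k) :=
  fun k => {f | IsProj f ∨ ∃ ω ∈ W k, 0 < ω f}

/-- An `r`-ary cost function on `D`, with values in `ℚ ∪ {∞}`. -/
abbrev CostF (D : Type) (r : ℕ) : Type := (Fin r → D) → WithTop ℚ

/-- The feasibility relation of a cost function. -/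
def Feas {D : Type} {r : ℕ} (ϱ : CostF D r) : Set (Fin r → D) := {x | ϱ x ≠ ⊤}

/-- Coordinate-wise application of a `k`-ary operation to `k` many `r`-tuples. -/
def appRows {D : Type} {k r : ℕ} (f : Op D k) (xs : Fin k → Fin r → D) : Fin r → D :=
  fun j => f fun i => xs i j

/-- `f` is a polymorphism of `ϱ`: `Feas ϱ` is closed under coordinate-wise application of `f`. -/
def IsPolymorphism {D : Type} {k r : ℕ} (f : Op D k) (ϱ : CostF D r) : Prop :=
  ∀ xs : Fin k → Fin r → D, (∀ i, xs i ∈ Feas ϱ) → appRows f xs ∈ Feas ϱ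

/-- A valued constraint language on `D`: a set of cost functions of various arities. -/
abbrev VLang (D : Type) : Type := Set (Σ r : ℕ, CostF D r)

/-- The clone of polymorphisms of a language. -/
def Pol {D : Type} (Γ : VLang D) : ∀ k, Set (Op D k) :=
  fun _ => {f | ∀ ϱ ∈ Γ, IsPolymorphism f ϱ.2}

/-- Multiplication of an element of `ℚ ∪ {∞}` by a rational scalar (`c·∞ = ∞`). -/
def qmul (c : ℚ) (x : WithTop ℚ) : WithTop ℚ := WithTop.map (fun q => c * q) x

/-- The sum `∑_f ω(f)·ϱ(f(x₁,…,x_k))`, over operations with non-zero weight. -/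
def wSum {D : Type} [Fintype D] [DecidableEq D] {k r : ℕ}
    (ω : Op D k → ℚ) (ϱ : CostF D r) (xs : Fin k → Fin r → D) : WithTop ℚ :=
  ∑ f ∈ Finset.univ.filter (fun f : Op D k => ω f ≠ 0), qmul (ω f) (ϱ (appRows f xs))

/-- `ω` is a weighted polymorphism of the language `Γ`. -/
def IsWeightedPolymorphism {D : Type} [Fintype D] [DecidableEq D] (Γ : VLang D)
    {k : ℕ} (ω : Op D k → ℚ) : Prop :=
  IsWeighting (Pol Γ) ω ∧
    ∀ ϱ ∈ Γ, ∀ xs : Fin k → Fin ϱ.1 → D, (∀ i, xs i ∈ Feas ϱ.2) → wSum ω ϱ.2 xs ≤ 0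

/-- The weighted polymorphisms of a language. -/
def wPol {D : Type} [Fintype D] [DecidableEq D] (Γ : VLang D) :
    ∀ k, Set (Op D k → ℚ) :=
  fun _ => {ω | IsWeightedPolymorphism Γ ω}

/-- The positive clone `Pol⁺(Γ)` of a language. -/
def PolPlus {D : Type} [Fintype D] [DecidableEq D] (Γ : VLang D) : ∀ k, Set (Op D k) :=
  posClone (wPol Γ)

/-- The map `D → D` induced by a unary operation. -/
def unaryFun {D : Type} (f : Op D 1) : D → D := fun x => f fun _ => x

/-- A language is a core if every unary operation in its positive clone is bijective. -/
def IsCore {D : Type} [Fintype D] [DecidableEq D] (Γ : VLang D) : Prop :=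
  ∀ f ∈ PolPlus Γ 1, Function.Bijective (unaryFun f)

/-- An idempotent operation. -/
def Idem {D : Type} {k : ℕ} (f : Op D k) : Prop := ∀ x : D, (f fun _ => x) = x

/-- A cyclic operation: `f(x₁,…,x_k) = f(x₂,…,x_k,x₁)`. -/
def CyclicOp {D : Type} {k : ℕ} (f : Op D k) : Prop :=
  ∀ x : Fin k → D, f x = f (x ∘ ⇑(finRotate k))

/-- A conservative operation. -/
def Conservative {D : Type} {k : ℕ} (f : Op D k) : Prop :=
  ∀ x : Fin k → D, ∃ i, f x = x i

/-- A Taylor operation. -/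
def IsTaylor {D : Type} {k : ℕ} (t : Op D k) : Prop :=
  Idem t ∧ ∀ j : Fin k, ∃ a b : Fin k → Fin 2, a j = 0 ∧ b j = 1 ∧
    ∀ u : Fin 2 → D, (t fun i => u (a i)) = t fun i => u (b i)

/-- An instance of `VCSP(Γ)` with variable set `V`: a finite multiset of constraints,
each a tuple of variables together with a cost function from `Γ`. -/
structure VInstance (D : Type) (Γ : VLang D) (V : Type) where
  cons : Multiset (Σ r : ℕ, (Fin r → V) × CostF D r)
  mem_lang : ∀ c ∈ cons, (⟨c.1, c.2.2⟩ : Σ r : ℕ, CostF D r) ∈ Γ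

/-- The cost of an assignment for a VCSP instance. -/
def VInstance.cost {D V : Type} {Γ : VLang D} (I : VInstance D Γ V) (s : V → D) :
    WithTop ℚ :=
  (I.cons.map fun c => c.2.2 fun i => s (c.2.1 i)).sum

/-- A cost function is expressible over a language `Δ`. -/
def Expressible {D : Type} [Fintype D] [DecidableEq D] (Δ : VLang D) {r : ℕ}
    (ϱ : CostF D r) : Prop :=
  ∃ (n : ℕ) (I : VInstance D Δ (Fin n)) (v : Fin r → Fin n),
    ∀ x : Fin r → D,
      ϱ x = (Finset.univ.filter fun s : Fin n → D => ∀ i, s (v i) = x i).inf fun s => I.cost s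

/-- A language is closed under expressibility, non-negative scaling and
addition of rational constants. -/
def IsWClosed {D : Type} [Fintype D] [DecidableEq D] (Δ : VLang D) : Prop :=
  (∀ (r : ℕ) (ϱ : CostF D r), Expressible Δ ϱ → (⟨r, ϱ⟩ : Σ r : ℕ, CostF D r) ∈ Δ) ∧
  (∀ (r : ℕ) (ϱ : CostF D r) (c : ℚ), 0 ≤ c → (⟨r, ϱ⟩ : Σ r : ℕ, CostF D r) ∈ Δ →
    (⟨r, fun x => qmul c (ϱ x)⟩ : Σ r : ℕ, CostF D r) ∈ Δ) ∧
  (∀ (r : ℕ) (ϱ : CostF D r) (c : ℚ), (⟨r, ϱ⟩ : Σ r : ℕ, CostF D r) ∈ Δ →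
    (⟨r, fun x => ϱ x + (c : WithTop ℚ)⟩ : Σ r : ℕ, CostF D r) ∈ Δ)

/-- The weighted relational clone generated by `Γ`: the smallest language containing `Γ`
closed under expressibility, non-negative scaling and addition of rational constants. -/
def wRelClo {D : Type} [Fintype D] [DecidableEq D] (Γ : VLang D) : VLang D :=
  ⋂₀ {Δ : VLang D | Γ ⊆ Δ ∧ IsWClosed Δ}

/-- The weighting `(1/k)(∑_i 1_{f_i} − ∑_i 1_{π_i})` associated with a `k`-tuple of
`k`-ary operations (a multimorphism), weights added with multiplicity. -/
def multimorphismW {D : Type} [Fintype D] [DecidableEq D] {k : ℕ} (F : Fin k → Op D k) :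
    Op D k → ℚ :=
  fun g => (1 / (k : ℚ)) *
    (((Finset.univ.filter fun i : Fin k => F i = g).card : ℚ) -
     ((Finset.univ.filter fun i : Fin k => proj D i = g).card : ℚ))

/-- `Γ` admits the multimorphism `⟨F 0, …, F (k-1)⟩`. -/
def AdmitsMultimorphism {D : Type} [Fintype D] [DecidableEq D] {k : ℕ}
    (Γ : VLang D) (F : Fin k → Op D k) : Prop :=
  multimorphismW F ∈ wPol Γ k

/-- An `m`-ary fractional operation: a probability distribution on `m`-ary operations. -/
def IsFracOp {D : Type} [Fintype D] [DecidableEq D] {m : ℕ} (ω : Op D m → ℝ) : Prop :=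
  (∀ f, 0 ≤ ω f) ∧ ∑ f : Op D m, ω f = 1

/-- Multiplication of an element of `ℚ ∪ {∞}` by a real scalar, landing in `ℝ ∪ {∞}`. -/
def rmul (c : ℝ) (x : WithTop ℚ) : WithTop ℝ := WithTop.map (fun q : ℚ => c * (q : ℝ)) x

/-- `ω` is a fractional polymorphism of the language `Γ`. -/
def IsFracPolymorphism {D : Type} [Fintype D] [DecidableEq D] (Γ : VLang D) {m : ℕ}
    (ω : Op D m → ℝ) : Prop :=
  IsFracOp ω ∧ ∀ ϱ ∈ Γ, ∀ xs : Fin m → Fin ϱ.1 → D, (∀ i, xs i ∈ Feas ϱ.2) →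
    (∑ g ∈ Finset.univ.filter fun g : Op D m => 0 < ω g, rmul (ω g) (ϱ.2 (appRows g xs)))
      ≤ rmul (1 / (m : ℝ)) (∑ i : Fin m, ϱ.2 (xs i))

/-- The positive clone `fPol⁺(Γ)` defined via fractional polymorphisms. -/
def fPolPlus {D : Type} [Fintype D] [DecidableEq D] (Γ : VLang D) : ∀ k, Set (Op D k) :=
  fun k => {f | IsProj f ∨ ∃ ω : Op D k → ℝ, IsFracPolymorphism Γ ω ∧ 0 < ω f}

/-- Application of a binary operation to two elements. -/
def ap2 {D : Type} (f : Op D 2) (a b : D) : D := f ![a, b]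

/-- Application of a ternary operation to three elements. -/
def ap3 {D : Type} (f : Op D 3) (a b c : D) : D := f ![a, b, c]

/-- A ternary operation restricts to a majority operation on a subset `S`. -/
def IsMajorityOn {D : Type} (f : Op D 3) (S : Set D) : Prop :=
  ∀ x ∈ S, ∀ y ∈ S, ap3 f x x y = x ∧ ap3 f x y x = x ∧ ap3 f y x x = x

/-- A ternary operation restricts to a minority operation on a subset `S`. -/
def IsMinorityOn {D : Type} (f : Op D 3) (S : Set D) : Prop :=
  ∀ x ∈ S, ∀ y ∈ S, ap3 f x x y = y ∧ ap3 f x y x = y ∧ ap3 f y x x = y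

/-- The language `Γ_c`: `Γ` together with all unary cost functions `N_a`
(`N_a(a) = 0`, `N_a(x) = ∞` for `x ≠ a`). -/
def withConstants {D : Type} [DecidableEq D] (Γ : VLang D) : VLang D :=
  Γ ∪ {p : Σ r : ℕ, CostF D r |
        ∃ a : D, p = ⟨1, fun x => if x 0 = a then (0 : WithTop ℚ) else ⊤⟩}

/-- A language is conservative if it contains every `{0,1}`-valued unary cost function. -/
def ConservativeLang {D : Type} (Γ : VLang D) : Prop :=
  ∀ ϱ : CostF D 1, (∀ x, ϱ x = 0 ∨ ϱ x = 1) → (⟨1, ϱ⟩ : Σ r : ℕ, CostF D r) ∈ Γ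

/-- The coordinate-wise action of a `k`-ary operation on `A` on the power `A^n`. -/
def opPow {A : Type} (n : ℕ) {k : ℕ} (f : Op A k) : Op (Fin n → A) k :=
  fun xs c => f fun i => xs i c

/-- Regrouping an `(n·r)`-tuple over `A` into an `r`-tuple of elements of `A^n`. -/
def regroup (A : Type) (n r : ℕ) (y : Fin (n * r) → A) : Fin r → Fin n → A :=
  fun j c => y (finProdFinEquiv (c, j))

section Framework

variable {D : Type}

lemma IsClone.ap2_mem {C : ∀ k, Set (Op D k)} (hC : IsClone C) {l : ℕ} {f : Op D 2}
    {g h : Op D l} (hf : f ∈ C 2) (hg : g ∈ C l) (hh : h ∈ C l) :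
    (fun x => ap2 f (g x) (h x)) ∈ C l := by
  have := hC.superpose_mem 2 l f ![g, h] hf (by simp [Fin.forall_fin_two, hg, hh])
  convert this using 1
  funext x
  simp only [ap2, superposeOp]
  congr 1
  funext i
  fin_cases i <;> rfl

lemma IsClone.ap3_mem {C : ∀ k, Set (Op D k)} (hC : IsClone C) {l : ℕ} {f : Op D 3}
    {g₀ g₁ g₂ : Op D l} (hf : f ∈ C 3) (h₀ : g₀ ∈ C l) (h₁ : g₁ ∈ C l) (h₂ : g₂ ∈ C l) :
    (fun x => ap3 f (g₀ x) (g₁ x) (g₂ x)) ∈ C l := by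
  have := hC.superpose_mem 3 l f ![g₀, g₁, g₂] hf
    (by simp [Fin.forall_fin_succ, h₀, h₁, h₂])
  convert this using 1
  funext x
  simp only [ap3, superposeOp]
  congr 1
  funext i
  fin_cases i <;> rfl

lemma IsClone.coord_mem {C : ∀ k, Set (Op D k)} (hC : IsClone C) {l : ℕ} (i : Fin l) :
    (fun x : Fin l → D => x i) ∈ C l :=
  hC.proj_mem l i

lemma IsClone.minor_mem {C : ∀ k, Set (Op D k)} (hC : IsClone C) {k l : ℕ} {f : Op D k}
    (hf : f ∈ C k) (c : Fin k → Fin l) : (fun x : Fin l → D => f fun i => x (c i)) ∈ C l :=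
  hC.superpose_mem k l f (fun i => proj D (c i)) hf fun i => hC.proj_mem l (c i)

lemma isClone_Pol (Γ : VLang D) : IsClone (Pol Γ) where
  proj_mem _ i _ _ _ hxs := hxs i
  superpose_mem _ _ _ g hf hg ϱ hϱ xs hxs :=
    hf ϱ hϱ (fun i => appRows (g i) xs) fun i => hg i ϱ hϱ xs hxs

variable [Fintype D] [DecidableEq D]

/-- The finite value of a cost function, with `∞` replaced by `0`. -/
def finCost {r : ℕ} (ϱ : CostF D r) (x : Fin r → D) : ℚ := (ϱ x).untopD 0

lemma wSum_eq_coe {Γ : VLang D} {k r : ℕ} {ω : Op D k → ℚ} {ϱ : CostF D r}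
    (hω : ∀ f, ω f ≠ 0 → f ∈ Pol Γ k) (hϱ : (⟨r, ϱ⟩ : Σ r : ℕ, CostF D r) ∈ Γ)
    {xs : Fin k → Fin r → D} (hxs : ∀ i, xs i ∈ Feas ϱ) :
    wSum ω ϱ xs = ((∑ f, ω f * finCost ϱ (appRows f xs) : ℚ) : WithTop ℚ) := by
  have h : ∑ f, ω f * finCost ϱ (appRows f xs) =
      ∑ f ∈ Finset.univ.filter (fun f : Op D k => ω f ≠ 0),
        ω f * finCost ϱ (appRows f xs) := by
    rw [Finset.sum_filter]
    refine Finset.sum_congr rfl fun f _ => ?_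
    by_cases h : ω f = 0 <;> simp [h]
  rw [h, wSum, WithTop.coe_sum]
  refine Finset.sum_congr rfl fun f hf => ?_
  have hf : ϱ (appRows f xs) ≠ ⊤ := hω f (by simpa using hf) ⟨r, ϱ⟩ hϱ xs hxs
  obtain ⟨q, hq⟩ := WithTop.ne_top_iff_exists.mp hf
  simp [qmul, finCost, ← hq]

lemma mem_wPol_iff {Γ : VLang D} {k : ℕ} {ω : Op D k → ℚ} :
    ω ∈ wPol Γ k ↔ IsWeighting (Pol Γ) ω ∧ ∀ ϱ ∈ Γ, ∀ xs : Fin k → Fin ϱ.1 → D,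
      (∀ i, xs i ∈ Feas ϱ.2) → ∑ f, ω f * finCost ϱ.2 (appRows f xs) ≤ 0 := by
  refine and_congr_right fun hω => forall₄_congr fun ϱ hϱ xs hxs => ?_
  rw [wSum_eq_coe hω.support_mem hϱ hxs]
  norm_cast

lemma PolPlus_subset_Pol (Γ : VLang D) {k : ℕ} {f : Op D k} (hf : f ∈ PolPlus Γ k) :
    f ∈ Pol Γ k := by
  rcases hf with ⟨i, rfl⟩ | ⟨ω, hω, h⟩
  · exact (isClone_Pol Γ).proj_mem k i
  · exact hω.1.support_mem f h.ne'

lemma sum_wSuperpose_mul {k l : ℕ} (ω : Op D k → ℚ) (g : Fin k → Op D l) (F : Op D l → ℚ) :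
    ∑ h, wSuperpose ω g h * F h = ∑ f, ω f * F (superposeOp f g) := by
  rw [← Finset.sum_fiberwise (g := fun f => superposeOp f g)]
  refine Finset.sum_congr rfl fun h _ => ?_
  rw [wSuperpose, Finset.sum_mul]
  refine Finset.sum_congr rfl fun f hf => ?_
  rw [(Finset.mem_filter.mp hf).2]

lemma isClone_PolPlus (Γ : VLang D) : IsClone (PolPlus Γ) where
  proj_mem k i := Or.inl ⟨i, rfl⟩
  superpose_mem k l f g hf hg := by
    classical
    by_cases hproj : IsProj (superposeOp f g)
    · exact Or.inl hproj
    by_cases hfg : ∃ i, superposeOp f g = g i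
    · obtain ⟨i, hi⟩ := hfg
      exact hi ▸ hg i
    rcases hf with ⟨i, rfl⟩ | ⟨ω, hω, hpos⟩
    · exact hg i
    have hχ : ∀ i, ∃ χ ∈ wPol Γ l, ¬ IsProj (g i) → 0 < χ (g i) := by
      intro i
      rcases hg i with h | ⟨χ, hχ, h⟩
      · refine ⟨fun _ => 0, mem_wPol_iff.mpr ⟨⟨by simp, by simp, by simp⟩, by simp⟩, ?_⟩
        exact fun h' => absurd h h'
      · exact ⟨χ, hχ, fun _ => h⟩
    choose χ hχ hχpos using hχ
    have hχnn : ∀ i h, ¬ IsProj h → 0 ≤ χ i h := fun i h hh =>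
      not_lt.mp fun hlt => hh ((hχ i).1.neg_imp_proj h hlt)
    have hwnn : ∀ h, (∀ i, h ≠ g i) → 0 ≤ wSuperpose ω g h := by
      intro h hh
      refine Finset.sum_nonneg fun f' hf' => not_lt.mp fun hlt => ?_
      obtain ⟨i, rfl⟩ := hω.1.neg_imp_proj f' hlt
      exact hh i (Finset.mem_filter.mp hf').2.symm
    set c : ℚ := ∑ i, |wSuperpose ω g (g i)| / |χ i (g i)| with hc
    have hc0 : 0 ≤ c := Finset.sum_nonneg fun i _ => by positivity
    have hω' := mem_wPol_iff.mp hω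
    have hχ' := fun i => mem_wPol_iff.mp (hχ i)
    have hsum : ∀ F : Op D l → ℚ,
        ∑ h, (wSuperpose ω g h + ∑ i, c * χ i h) * F h =
          ∑ f, ω f * F (superposeOp f g) + ∑ i, c * ∑ h, χ i h * F h := by
      intro F
      simp only [add_mul, Finset.sum_add_distrib, sum_wSuperpose_mul, Finset.sum_mul,
        Finset.mul_sum, mul_assoc]
      rw [Finset.sum_comm]
    refine Or.inr ⟨fun h => wSuperpose ω g h + ∑ i, c * χ i h,
      mem_wPol_iff.mpr ⟨⟨?_, ?_, ?_⟩, ?_⟩, ?_⟩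
    · intro h hne
      by_contra hmem
      refine hne ?_
      have h1 : ∀ i, χ i h = 0 := fun i => by
        by_contra hi
        exact hmem ((hχ i).1.support_mem h hi)
      have h2 : wSuperpose ω g h = 0 := by
        refine Finset.sum_eq_zero fun f' hf' => ?_
        by_contra hne'
        rw [← (Finset.mem_filter.mp hf').2] at hmem
        exact hmem ((isClone_Pol Γ).superpose_mem k l f' g (hω.1.support_mem f' hne')
          fun i => PolPlus_subset_Pol Γ (hg i))
      simp [h1, h2]
    · have := hsum fun _ => 1
      simp only [mul_one, hω.1.sum_zero, (hχ _).1.sum_zero] at this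
      simpa using this
    · intro h
      contrapose!
      intro hh
      by_cases hgi : ∃ i, h = g i
      · obtain ⟨i, rfl⟩ := hgi
        have hχi := hχpos i hh
        have h1 : |wSuperpose ω g (g i)| ≤ c * χ i (g i) := by
          have h2 : |wSuperpose ω g (g i)| / |χ i (g i)| ≤ c :=
            Finset.single_le_sum (f := fun i => |wSuperpose ω g (g i)| / |χ i (g i)|)
              (fun i _ => by positivity) (Finset.mem_univ i)
          rwa [abs_of_pos hχi, div_le_iff₀ hχi] at h2
        have h3 : c * χ i (g i) ≤ ∑ j, c * χ j (g i) :=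
          Finset.single_le_sum (f := fun j => c * χ j (g i))
            (fun j _ => mul_nonneg hc0 (hχnn j _ hh)) (Finset.mem_univ i)
        linarith [neg_abs_le (wSuperpose ω g (g i))]
      · push Not at hgi
        exact add_nonneg (hwnn h hgi)
          (Finset.sum_nonneg fun j _ => mul_nonneg hc0 (hχnn j _ hh))
    · intro ϱ hϱ xs hxs
      rw [hsum fun h => finCost ϱ.2 (appRows h xs)]
      have h1 := hω'.2 ϱ hϱ (fun i => appRows (g i) xs)
        fun i => PolPlus_subset_Pol Γ (hg i) ϱ hϱ xs hxs
      have h2 : ∑ i, c * ∑ h, χ i h * finCost ϱ.2 (appRows h xs) ≤ 0 :=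
        Finset.sum_nonpos fun i _ =>
          mul_nonpos_of_nonneg_of_nonpos hc0 ((hχ' i).2 ϱ hϱ xs hxs)
      exact add_nonpos h1 h2
    · push Not at hfg
      refine add_pos_of_pos_of_nonneg ?_
        (Finset.sum_nonneg fun j _ => mul_nonneg hc0 (hχnn j _ hproj))
      refine Finset.sum_pos' (fun f' hf' => not_lt.mp fun hlt => ?_)
        ⟨f, by simp, hpos⟩
      obtain ⟨i, rfl⟩ := hω.1.neg_imp_proj f' hlt
      exact hfg i (Finset.mem_filter.mp hf').2.symm

/-- A clone of conservative operations in which every operation other than a projection has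
positive weight in some signed weighting whose distribution of values is zero on each tuple. -/
structure IsBalancedClone (C : ∀ k, Set (Op D k)) : Prop extends IsClone C where
  conservative : ∀ {k : ℕ} {f : Op D k}, f ∈ C k → Conservative f
  exists_balanced : ∀ {k : ℕ} {f : Op D k}, f ∈ C k → ¬ IsProj f →
    ∃ ω : Op D k → ℚ, IsWeighting C ω ∧ 0 < ω f ∧
      ∀ (u : Fin k → D) (a : D), ∑ g, ω g * (if g u = a then 1 else 0) = 0

lemma isBalancedClone_PolPlus {Γ : VLang D}
    (hall : ∀ ϱ : CostF D 1, (⟨1, ϱ⟩ : Σ r : ℕ, CostF D r) ∈ Γ) :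
    IsBalancedClone (PolPlus Γ) where
  toIsClone := isClone_PolPlus Γ
  conservative {k f} hf u := by
    classical
    have h := PolPlus_subset_Pol Γ hf
      ⟨1, fun x => if ∃ i, x 0 = u i then 0 else ⊤⟩ (hall _) (fun i _ => u i)
      (fun i => by
        show (if ∃ j, u i = u j then (0 : WithTop ℚ) else ⊤) ≠ ⊤
        rw [if_pos ⟨i, rfl⟩]
        simp)
    by_contra hne
    refine h ?_
    exact if_neg hne
  exists_balanced {k f} hf hproj := by
    rcases hf with hf | ⟨ω, hω, hpos⟩
    · exact absurd hf hproj
    have key : ∀ (u : Fin k → D) (a : D) (c : ℚ),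
        ∑ g, ω g * (if g u = a then c else 0) ≤ 0 := by
      intro u a c
      have := (mem_wPol_iff.mp hω).2 ⟨1, fun x => ((if x 0 = a then c else 0 : ℚ) : WithTop ℚ)⟩
        (hall _) (fun i _ => u i) (fun i => WithTop.coe_ne_top)
      simp only [finCost, WithTop.untopD_coe] at this
      exact this
    refine ⟨ω, ⟨fun g hg => ?_, hω.1.sum_zero, hω.1.neg_imp_proj⟩, hpos,
      fun u a => le_antisymm (key u a 1) ?_⟩
    · rcases lt_or_gt_of_ne hg with h | h
      · exact Or.inl (hω.1.neg_imp_proj g h)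
      · exact Or.inr ⟨ω, hω, h⟩
    · have := key u a (-1)
      rw [← neg_nonpos, ← Finset.sum_neg_distrib]
      refine le_trans (Finset.sum_le_sum fun g _ => ?_) this
      split_ifs <;> simp

end Framework

section Majority

variable {D : Type} [Fintype D] [DecidableEq D] {C : ∀ k, Set (Op D k)}

/-- `g` takes the value `a` on the triples with two entries `a` and one entry `b`. -/
def MajorityAt (a b : D) (g : Op D 3) : Prop :=
  ap3 g a a b = a ∧ ap3 g a b a = a ∧ ap3 g b a a = a

/-- `g` restricts to a majority operation on `{a, b}`, provided it is idempotent. -/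
def MajorityOnPair (a b : D) (g : Op D 3) : Prop :=
  MajorityAt a b g ∧ MajorityAt b a g

/-- Some binary operation of `C` commutes on the pair `{a, b}`. -/
def CommutesAt (C : ∀ k, Set (Op D k)) (a b : D) : Prop :=
  ∃ f ∈ C 2, ap2 f a b = ap2 f b a

lemma ap3_ap3 {D : Type} {t : Op D 3} (g₀ g₁ g₂ : Op D 3) (a b c : D) :
    ap3 (fun x => ap3 t (g₀ x) (g₁ x) (g₂ x)) a b c =
      ap3 t (g₀ ![a, b, c]) (g₁ ![a, b, c]) (g₂ ![a, b, c]) :=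
  rfl

namespace IsBalancedClone

lemma ap2_self (hC : IsBalancedClone C) {f : Op D 2} (hf : f ∈ C 2) (a : D) :
    ap2 f a a = a := by
  obtain ⟨i, hi⟩ := hC.conservative hf ![a, a]
  fin_cases i <;> exact hi

lemma ap2_eq_or (hC : IsBalancedClone C) {f : Op D 2} (hf : f ∈ C 2) (a b : D) :
    ap2 f a b = a ∨ ap2 f a b = b := by
  obtain ⟨i, hi⟩ := hC.conservative hf ![a, b]
  fin_cases i
  · exact Or.inl hi
  · exact Or.inr hi

lemma ap3_self (hC : IsBalancedClone C) {f : Op D 3} (hf : f ∈ C 3) (a : D) :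
    ap3 f a a a = a := by
  obtain ⟨i, hi⟩ := hC.conservative hf ![a, a, a]
  fin_cases i <;> exact hi

/-- Where no binary operation of `C` commutes, every binary operation is a projection. -/
lemma ap2_eq_iff (hC : IsBalancedClone C) {a b : D} (hab : a ≠ b)
    (hnc : ¬ CommutesAt C a b) {f : Op D 2} (hf : f ∈ C 2) :
    ap2 f a b = a ↔ ap2 f b a = b := by
  have hne : ap2 f a b ≠ ap2 f b a := fun h => hnc ⟨f, hf, h⟩
  rcases hC.ap2_eq_or hf a b with h | h <;> rcases hC.ap2_eq_or hf b a with h' | h' <;>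
    grind

lemma ap2_cases (hC : IsBalancedClone C) {a b : D} (hab : a ≠ b)
    (hnc : ¬ CommutesAt C a b) {f : Op D 2} (hf : f ∈ C 2) :
    (ap2 f a b = a ∧ ap2 f b a = b) ∨ (ap2 f a b = b ∧ ap2 f b a = a) := by
  have h₁ := hC.ap2_eq_iff hab hnc hf
  have h₂ := hC.ap2_eq_or hf a b
  have h₃ := hC.ap2_eq_or hf b a
  grind

lemma minor_cases (hC : IsBalancedClone C) {a b : D} (hab : a ≠ b)
    (hnc : ¬ CommutesAt C a b) {k : ℕ} {f : Op D k} (hf : f ∈ C k) (X : Finset (Fin k)) :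
    ((f fun i => if i ∈ X then a else b) = a ∧ (f fun i => if i ∈ X then b else a) = b) ∨
      ((f fun i => if i ∈ X then a else b) = b ∧ (f fun i => if i ∈ X then b else a) = a) := by
  have h := hC.ap2_cases hab hnc (hC.minor_mem hf fun i => if i ∈ X then (0 : Fin 2) else 1)
  have e : ∀ c d : D, ap2 (fun x => f fun i => x (if i ∈ X then (0 : Fin 2) else 1)) c d =
      f fun i => if i ∈ X then c else d := by
    intro c d
    simp only [ap2]
    congr 1
    funext i
    split_ifs <;> rfl
  simpa only [e] using h

lemma majorityOnPair_of_majorityAt (hC : IsBalancedClone C) {a b : D} (hab : a ≠ b)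
    (hnc : ¬ CommutesAt C a b) {t : Op D 3} (ht : t ∈ C 3) (h : MajorityAt a b t) :
    MajorityOnPair a b t := by
  refine ⟨h, ?_, ?_, ?_⟩
  · exact (hC.ap2_eq_iff hab hnc (hC.ap3_mem (g₀ := fun x : Fin 2 → D => x 0)
      (g₁ := fun x => x 0) (g₂ := fun x => x 1) ht (hC.coord_mem 0) (hC.coord_mem 0)
      (hC.coord_mem 1))).mp h.1
  · exact (hC.ap2_eq_iff hab hnc (hC.ap3_mem (g₀ := fun x : Fin 2 → D => x 0)
      (g₁ := fun x => x 1) (g₂ := fun x => x 0) ht (hC.coord_mem 0) (hC.coord_mem 1)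
      (hC.coord_mem 0))).mp h.2.1
  · exact (hC.ap2_eq_iff hab hnc (hC.ap3_mem (g₀ := fun x : Fin 2 → D => x 1)
      (g₁ := fun x => x 0) (g₂ := fun x => x 0) ht (hC.coord_mem 1) (hC.coord_mem 0)
      (hC.coord_mem 0))).mp h.2.2

/-- A ternary operation agreeing with majority less often than a projection is balanced by one
which agrees with majority everywhere. -/
lemma exists_majorityAt_of_minority (hC : IsBalancedClone C) {a b : D} (hab : a ≠ b)
    {g : Op D 3} (hg : g ∈ C 3) (h₁ : ap3 g b a a ≠ a) (h₂ : ap3 g a b a ≠ a) :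
    ∃ m ∈ C 3, MajorityAt a b m := by
  have hproj : ¬ IsProj g := by
    rintro ⟨i, rfl⟩
    fin_cases i <;> simp_all [ap3, proj]
  obtain ⟨ω, hω, hpos, hbal⟩ := hC.exists_balanced hg hproj
  let r : Op D 3 → ℚ := fun h =>
    (if ap3 h a a b = a then 1 else 0) + (if ap3 h a b a = a then 1 else 0) +
      (if ap3 h b a a = a then 1 else 0)
  have e₁ : ∑ h, ω h * (if ap3 h a a b = a then 1 else 0) = 0 := hbal ![a, a, b] a
  have e₂ : ∑ h, ω h * (if ap3 h a b a = a then 1 else 0) = 0 := hbal ![a, b, a] a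
  have e₃ : ∑ h, ω h * (if ap3 h b a a = a then 1 else 0) = 0 := hbal ![b, a, a] a
  have hr : ∑ h, ω h * (r h - 2) = 0 := by
    simp only [r, mul_sub, mul_add, Finset.sum_sub_distrib, Finset.sum_add_distrib,
      ← Finset.sum_mul, hω.sum_zero, e₁, e₂, e₃]
    norm_num
  have hgr : ω g * (r g - 2) < 0 := by
    refine mul_neg_of_pos_of_neg hpos ?_
    simp only [r, h₁, h₂, if_false]
    split_ifs <;> norm_num
  have hex : ∃ h, 0 < ω h * (r h - 2) := by
    by_contra! hall
    have := Finset.sum_neg' (fun h _ => hall h) ⟨g, Finset.mem_univ g, hgr⟩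
    exact absurd hr this.ne
  obtain ⟨m, hm⟩ := hex
  have hωm : 0 < ω m := by
    refine lt_of_not_ge fun hle => ?_
    rcases hle.lt_or_eq with hlt | heq
    · obtain ⟨i, rfl⟩ := hω.neg_imp_proj m hlt
      have : r (proj D i) = 2 := by
        fin_cases i <;> simp [r, ap3, proj, hab.symm] <;> norm_num
      simp [this] at hm
    · simp [heq] at hm
  have hrm : 0 < r m - 2 := (mul_pos_iff_of_pos_left hωm).mp hm
  refine ⟨m, hω.support_mem m hωm.ne', ?_⟩
  simp only [r] at hrm
  refine ⟨?_, ?_, ?_⟩ <;> by_contra hne <;> simp only [hne, if_false] at hrm <;>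
    split_ifs at hrm <;> norm_num at hrm

/-- On a pair where no binary operation commutes, a cyclic operation yields a majority. -/
lemma exists_majorityOnPair (hC : IsBalancedClone C) {a b : D} (hab : a ≠ b)
    (hnc : ¬ CommutesAt C a b) {k : ℕ} (hk : 1 < k) {f : Op D k} (hf : f ∈ C k)
    (hcyc : CyclicOp f) : ∃ m ∈ C 3, MajorityOnPair a b m := by
  classical
  suffices h : ∃ m ∈ C 3, MajorityAt a b m by
    obtain ⟨m, hm, h⟩ := h
    exact ⟨m, hm, hC.majorityOnPair_of_majorityAt hab hnc hm h⟩
  let win : Finset (Fin k) → Prop := fun X => (f fun i => if i ∈ X then a else b) = a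
  have hwin : ∀ X, win X → (f fun i => if i ∈ X then b else a) = b := by
    intro X hX
    have := hC.minor_cases hab hnc hf X
    grind
  have hlose : ∀ X, ¬ win X → (f fun i => if i ∈ X then b else a) = a := by
    intro X hX
    have := hC.minor_cases hab hnc hf X
    grind
  have hidem : ∀ c : D, (f fun _ => c) = c := fun c => (hC.conservative hf fun _ => c).choose_spec
  obtain ⟨X, hX, hmin⟩ := Finset.exists_min_image (Finset.univ.filter win) Finset.card
    ⟨Finset.univ, by simp [win, hidem]⟩
  simp only [Finset.mem_filter, Finset.mem_univ, true_and] at hX hmin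
  have hne : X.Nonempty := by
    rw [Finset.nonempty_iff_ne_empty]
    rintro rfl
    simp only [win, Finset.notMem_empty, if_false, hidem] at hX
    exact hab hX.symm
  obtain ⟨i, hi⟩ := hne
  by_cases hcard : X = {i}
  · subst hcard
    set j := (finRotate k).symm i with hj
    have hji : j ≠ i := by
      intro h
      obtain ⟨n, rfl⟩ : ∃ n, k = n + 1 := ⟨k - 1, by omega⟩
      have h' : finRotate (n + 1) i = i := by
        conv_lhs => rw [← h, hj, Equiv.apply_symm_apply]
      rw [finRotate_apply] at h'
      have : (1 : Fin (n + 1)) = 0 := by simpa using h'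
      have h3 := congrArg Fin.val this
      simp [Nat.mod_eq_of_lt hk] at h3
    have hjw : win {j} := by
      have := hcyc fun l => if l ∈ ({i} : Finset (Fin k)) then a else b
      refine Eq.trans (Eq.trans ?_ this.symm) hX
      congr 1
      funext l
      simp only [Finset.mem_singleton, hj, Equiv.eq_symm_apply, Function.comp_apply]
    refine hC.exists_majorityAt_of_minority hab
      (hC.minor_mem hf fun l => if l = i then (0 : Fin 3) else if l = j then 1 else 2) ?_ ?_
    · have h := hwin _ hX
      intro h'
      refine hab (h'.symm.trans (Eq.trans ?_ h))
      simp only [ap3]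
      congr 1
      funext l
      by_cases hl : l = i <;> by_cases hl' : l = j <;> simp_all
    · have h := hwin _ hjw
      intro h'
      refine hab (h'.symm.trans (Eq.trans ?_ h))
      simp only [ap3]
      congr 1
      funext l
      by_cases hl : l = i <;> by_cases hl' : l = j <;> simp_all
  · have h₁ : ¬ win {i} := fun h => by
      have hle := hmin _ h
      exact hcard (Finset.eq_of_subset_of_card_le (by simpa using hi) hle).symm
    have h₂ : ¬ win (X.erase i) := fun h => by
      have hle := hmin _ h
      have := Finset.card_erase_lt_of_mem hi
      omega
    refine ⟨_, hC.minor_mem hf fun l => if l = i then (0 : Fin 3) else if l ∈ X then 1 else 2,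
      ?_, ?_, ?_⟩
    · refine Eq.trans ?_ hX
      simp only [ap3]
      congr 1
      funext l
      by_cases hl : l = i <;> by_cases hl' : l ∈ X <;> simp_all
    · refine Eq.trans ?_ (hlose _ h₂)
      simp only [ap3]
      congr 1
      funext l
      by_cases hl : l = i <;> by_cases hl' : l ∈ X <;> simp_all
    · refine Eq.trans ?_ (hlose _ h₁)
      simp only [ap3]
      congr 1
      funext l
      by_cases hl : l = i <;> by_cases hl' : l ∈ X <;> simp_all

/-- One more pair can be added to those on which a ternary operation is a majority. -/
lemma exists_majorityOnPair_extend (hC : IsBalancedClone C) {a b : D} (hab : a ≠ b)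
    (hnc : ¬ CommutesAt C a b) {m t : Op D 3} (hm : m ∈ C 3) (hma : MajorityOnPair a b m)
    (ht : t ∈ C 3) :
    ∃ t' ∈ C 3, MajorityOnPair a b t' ∧ ∀ x y, MajorityOnPair x y t → MajorityOnPair x y t' := by
  have x₀ := hC.coord_mem (0 : Fin 3)
  have x₁ := hC.coord_mem (1 : Fin 3)
  have x₂ := hC.coord_mem (2 : Fin 3)
  have it := hC.ap3_self ht
  obtain ⟨⟨m₁, m₂, m₃⟩, m₄, m₅, m₆⟩ := hma
  have im := hC.ap3_self hm
  have two_of_three : ∀ {s : Op D 3}, s ∈ C 3 →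
      (∀ x y, MajorityOnPair x y t → MajorityOnPair x y s) →
      ap3 m (ap3 s a a b) (ap3 s a b a) (ap3 s b a a) = a →
      ap3 m (ap3 s a b a) (ap3 s b a a) (ap3 s a a b) = a →
      ap3 m (ap3 s b a a) (ap3 s a a b) (ap3 s a b a) = a →
      ∃ t' ∈ C 3, MajorityOnPair a b t' ∧
        ∀ x y, MajorityOnPair x y t → MajorityOnPair x y t' := by
    intro s hs hst e₁ e₂ e₃
    have hmem := hC.ap3_mem hm (hC.ap3_mem hs x₀ x₁ x₂) (hC.ap3_mem hs x₁ x₂ x₀)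
      (hC.ap3_mem hs x₂ x₀ x₁)
    refine ⟨_, hmem, hC.majorityOnPair_of_majorityAt hab hnc hmem ⟨e₁, e₂, e₃⟩, ?_⟩
    intro x y hxy
    obtain ⟨⟨s₁, s₂, s₃⟩, s₄, s₅, s₆⟩ := hst x y hxy
    simp [MajorityOnPair, MajorityAt, ap3_ap3, im, s₁, s₂, s₃, s₄, s₅, s₆]
  have y₀ := hC.coord_mem (0 : Fin 2)
  have y₁ := hC.coord_mem (1 : Fin 2)
  have c₁ : (ap3 t a a b = a ∧ ap3 t b b a = b) ∨ (ap3 t a a b = b ∧ ap3 t b b a = a) :=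
    hC.ap2_cases hab hnc (hC.ap3_mem ht y₀ y₀ y₁)
  have c₂ : (ap3 t a b a = a ∧ ap3 t b a b = b) ∨ (ap3 t a b a = b ∧ ap3 t b a b = a) :=
    hC.ap2_cases hab hnc (hC.ap3_mem ht y₀ y₁ y₀)
  have c₃ : (ap3 t b a a = a ∧ ap3 t a b b = b) ∨ (ap3 t b a a = b ∧ ap3 t a b b = a) :=
    hC.ap2_cases hab hnc (hC.ap3_mem ht y₁ y₀ y₀)
  rcases c₁ with ⟨f₁, f₂⟩ | ⟨f₁, f₂⟩ <;> rcases c₂ with ⟨f₃, f₄⟩ | ⟨f₃, f₄⟩ <;>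
    rcases c₃ with ⟨f₅, f₆⟩ | ⟨f₅, f₆⟩
  · exact ⟨t, ht, ⟨⟨f₁, f₃, f₅⟩, f₂, f₄, f₆⟩, fun _ _ => id⟩
  · exact two_of_three ht (fun _ _ => id) (by simp [*]) (by simp [*]) (by simp [*])
  · exact two_of_three ht (fun _ _ => id) (by simp [*]) (by simp [*]) (by simp [*])
  · refine ⟨_, hC.ap3_mem ht x₀ x₁ (hC.ap3_mem ht x₀ x₁ x₂), ?_, ?_⟩
    · simp [MajorityOnPair, MajorityAt, ap3_ap3, it, f₁, f₂, f₃, f₄, f₅, f₆]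
    · rintro x y ⟨⟨s₁, s₂, s₃⟩, s₄, s₅, s₆⟩
      simp [MajorityOnPair, MajorityAt, ap3_ap3, it, s₁, s₂, s₃, s₄, s₅, s₆]
  · exact two_of_three ht (fun _ _ => id) (by simp [*]) (by simp [*]) (by simp [*])
  · refine ⟨_, hC.ap3_mem ht x₀ (hC.ap3_mem ht x₀ x₁ x₂) x₂, ?_, ?_⟩
    · simp [MajorityOnPair, MajorityAt, ap3_ap3, it, f₁, f₂, f₃, f₄, f₅, f₆]
    · rintro x y ⟨⟨s₁, s₂, s₃⟩, s₄, s₅, s₆⟩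
      simp [MajorityOnPair, MajorityAt, ap3_ap3, it, s₁, s₂, s₃, s₄, s₅, s₆]
  · refine ⟨_, hC.ap3_mem ht (hC.ap3_mem ht x₀ x₁ x₂) x₁ x₂, ?_, ?_⟩
    · simp [MajorityOnPair, MajorityAt, ap3_ap3, it, f₁, f₂, f₃, f₄, f₅, f₆]
    · rintro x y ⟨⟨s₁, s₂, s₃⟩, s₄, s₅, s₆⟩
      simp [MajorityOnPair, MajorityAt, ap3_ap3, it, s₁, s₂, s₃, s₄, s₅, s₆]
  · refine two_of_three (hC.ap3_mem ht (hC.ap3_mem ht x₀ x₁ x₂) x₁ x₂) ?_ ?_ ?_ ?_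
    · rintro x y ⟨⟨s₁, s₂, s₃⟩, s₄, s₅, s₆⟩
      simp [MajorityOnPair, MajorityAt, ap3_ap3, it, s₁, s₂, s₃, s₄, s₅, s₆]
    all_goals simp [ap3_ap3, m₁, m₂, m₃, f₁, f₂, f₃, f₄, f₅]

/-- Given a cyclic operation, a ternary operation which is a majority on all pairs with a commuting
binary operation yields a majority operation. -/
lemma exists_majority (hC : IsBalancedClone C) {k : ℕ} (hk : 1 < k) {f : Op D k} (hf : f ∈ C k)
    (hcyc : CyclicOp f) {m₀ : Op D 3} (hm₀ : m₀ ∈ C 3)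
    (hcomm : ∀ a b, a ≠ b → CommutesAt C a b → MajorityAt a b m₀) :
    ∃ m ∈ C 3, ∀ a b, a ≠ b → MajorityAt a b m := by
  classical
  let S : Op D 3 → Finset (D × D) := fun g =>
    Finset.univ.filter fun p => MajorityOnPair p.1 p.2 g
  obtain ⟨m, hm, hmax⟩ := Finset.exists_max_image
    (Finset.univ.filter fun g : Op D 3 => g ∈ C 3 ∧
      ∀ a b, a ≠ b → CommutesAt C a b → MajorityOnPair a b g) (fun g => (S g).card)
    ⟨m₀, by
      simp only [Finset.mem_filter, Finset.mem_univ, true_and]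
      refine ⟨hm₀, fun a b hab h => ⟨hcomm a b hab h, hcomm b a hab.symm ?_⟩⟩
      exact h.imp fun g hg => ⟨hg.1, hg.2.symm⟩⟩
  simp only [Finset.mem_filter, Finset.mem_univ, true_and] at hm hmax
  suffices h : ∀ a b, a ≠ b → MajorityOnPair a b m from
    ⟨m, hm.1, fun a b hab => (h a b hab).1⟩
  intro a b hab
  by_contra hnot
  have hnc : ¬ CommutesAt C a b := fun h => hnot (hm.2 a b hab h)
  obtain ⟨m₁, hm₁, hmaj₁⟩ := hC.exists_majorityOnPair hab hnc hk hf hcyc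
  obtain ⟨t, ht, htab, hext⟩ := hC.exists_majorityOnPair_extend hab hnc hm₁ hmaj₁ hm.1
  refine absurd (hmax t ⟨ht, fun x y hxy h => hext x y (hm.2 x y hxy h)⟩) (not_le.mpr ?_)
  refine Finset.card_lt_card ⟨fun p hp => ?_, fun hsub => hnot ?_⟩
  · simp only [S, Finset.mem_filter, Finset.mem_univ, true_and] at hp ⊢
    exact hext _ _ hp
  · have : (a, b) ∈ S m := hsub (by simpa [S] using htab)
    simpa [S] using this

end IsBalancedClone

end Majority

section Amplification

/-- The triple with entry `b` at position `j` and `a` elsewhere. -/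
def nearConst {D : Type} (a b : D) (j : Fin 3) : Fin 3 → D := Function.update (fun _ => a) j b

lemma majorityAt_iff {D : Type} {a b : D} {g : Op D 3} :
    MajorityAt a b g ↔ ∀ j, g (nearConst a b j) = a := by
  have h₀ : nearConst a b 0 = ![b, a, a] := by
    funext i; fin_cases i <;> simp [nearConst]
  have h₁ : nearConst a b 1 = ![a, b, a] := by
    funext i; fin_cases i <;> simp [nearConst]
  have h₂ : nearConst a b 2 = ![a, a, b] := by
    funext i; fin_cases i <;> simp [nearConst]
  simp only [Fin.forall_fin_succ, Fin.forall_fin_zero, MajorityAt, ap3]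
  simp [h₀, h₁, h₂]
  tauto

variable {D : Type} [Fintype D] [DecidableEq D] {C : ∀ k, Set (Op D k)}

/-- A probability distribution on the `k`-ary operations of `C`. -/
structure IsLaw (C : ∀ k, Set (Op D k)) {k : ℕ} (μ : Op D k → ℝ) : Prop where
  nonneg : ∀ g, 0 ≤ μ g
  sum_one : ∑ g, μ g = 1
  support_mem : ∀ g, μ g ≠ 0 → g ∈ C k

/-- The probability that a random operation maps the tuple `u` to `a`. -/
def valueProb {k : ℕ} (μ : Op D k → ℝ) (u : Fin k → D) (a : D) : ℝ :=
  ∑ g, μ g * (if g u = a then 1 else 0)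

/-- The ternary operation `v(v(w(g₀,g₁), w(g₀,g₂)), w(g₁,g₂))`. -/
def amplifyOp (v w : Op D 2) (g₀ g₁ g₂ : Op D 3) : Op D 3 := fun x =>
  ap2 v (ap2 v (ap2 w (g₀ x) (g₁ x)) (ap2 w (g₀ x) (g₂ x))) (ap2 w (g₁ x) (g₂ x))

/-- The law of `amplifyOp` on independent operations of law `ν`, `ν`, `μ`, `μ`, `μ`. -/
def amplifyLaw (ν : Op D 2 → ℝ) (μ : Op D 3 → ℝ) (h : Op D 3) : ℝ :=
  ∑ i : Op D 2 × Op D 2 × Op D 3 × Op D 3 × Op D 3,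
    ν i.1 * (ν i.2.1 * (μ i.2.2.1 * (μ i.2.2.2.1 * (μ i.2.2.2.2 *
      (if amplifyOp i.1 i.2.1 i.2.2.1 i.2.2.2.1 i.2.2.2.2 = h then 1 else 0)))))

lemma sum_amplifyLaw_mul (ν : Op D 2 → ℝ) (μ : Op D 3 → ℝ) (F : Op D 3 → ℝ) :
    ∑ h, amplifyLaw ν μ h * F h =
      ∑ v, ν v * ∑ w, ν w * ∑ g₀, μ g₀ * ∑ g₁, μ g₁ * ∑ g₂, μ g₂ *
        F (amplifyOp v w g₀ g₁ g₂) := by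
  simp only [amplifyLaw, Finset.sum_mul]
  rw [Finset.sum_comm]
  simp only [mul_assoc, ← Finset.mul_sum, ite_mul, one_mul, zero_mul, Finset.sum_ite_eq,
    Finset.mem_univ, if_true, Fintype.sum_prod_type]

lemma IsLaw.amplify (hC : IsClone C) {ν : Op D 2 → ℝ} {μ : Op D 3 → ℝ} (hν : IsLaw C ν)
    (hμ : IsLaw C μ) : IsLaw C (amplifyLaw ν μ) where
  nonneg h := Finset.sum_nonneg fun i _ => by
    have h₁ := hν.nonneg i.1
    have h₂ := hν.nonneg i.2.1
    have h₃ := hμ.nonneg i.2.2.1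
    have h₄ := hμ.nonneg i.2.2.2.1
    have h₅ := hμ.nonneg i.2.2.2.2
    positivity
  sum_one := by
    have := sum_amplifyLaw_mul ν μ fun _ => 1
    simpa only [mul_one, hν.sum_one, hμ.sum_one] using this
  support_mem h hne := by
    obtain ⟨⟨v, w, g₀, g₁, g₂⟩, -, hi⟩ := Finset.exists_ne_zero_of_sum_ne_zero hne
    simp only [ne_eq, mul_eq_zero, not_or, ite_eq_right_iff, one_ne_zero, imp_false,
      not_not] at hi
    obtain ⟨hv, hw, h₀, h₁, h₂, rfl⟩ := hi
    have hv := hν.support_mem _ hv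
    have hw := hν.support_mem _ hw
    have h₀ := hμ.support_mem _ h₀
    have h₁ := hμ.support_mem _ h₁
    have h₂ := hμ.support_mem _ h₂
    exact hC.ap2_mem hv (hC.ap2_mem hv (hC.ap2_mem hw h₀ h₁) (hC.ap2_mem hw h₀ h₂))
      (hC.ap2_mem hw h₁ h₂)

lemma IsLaw.sum_mul_apply {k : ℕ} {μ : Op D k → ℝ} (hμ : IsLaw C μ) {a b : D} (hab : a ≠ b)
    {u : Fin k → D} (hu : ∀ g ∈ C k, g u = a ∨ g u = b) (F : D → ℝ) :
    ∑ g, μ g * F (g u) = valueProb μ u a * F a + (1 - valueProb μ u a) * F b := by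
  rw [← hμ.sum_one, valueProb, ← Finset.sum_sub_distrib, Finset.sum_mul, Finset.sum_mul,
    ← Finset.sum_add_distrib]
  refine Finset.sum_congr rfl fun g _ => ?_
  by_cases h0 : μ g = 0
  · simp [h0]
  · rcases hu g (hμ.support_mem g h0) with h | h <;> simp [h, hab.symm]

/-- A law on binary operations for which both values are equally likely on every pair. -/
structure IsFairLaw (C : ∀ k, Set (Op D k)) (ν : Op D 2 → ℝ) : Prop extends IsLaw C ν where
  left : ∀ a b, a ≠ b → ∑ g, ν g * (if ap2 g a b = a then 1 else 0) = 1 / 2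
  right : ∀ a b, a ≠ b → ∑ g, ν g * (if ap2 g a b = b then 1 else 0) = 1 / 2

/-- The probability that a random binary operation maps `(a, b)` and `(b, a)` to `a`. -/
def meetProb (ν : Op D 2 → ℝ) (a b : D) : ℝ :=
  ∑ g, ν g * ((if ap2 g a b = a then 1 else 0) * (if ap2 g b a = a then 1 else 0))

lemma IsFairLaw.sum_mul_apply (hC : IsBalancedClone C) {ν : Op D 2 → ℝ} (hν : IsFairLaw C ν)
    {a b : D} (hab : a ≠ b) (F : Op D 2 → ℝ) (H : D → D → ℝ)
    (hF : ∀ g ∈ C 2, F g = H (ap2 g a b) (ap2 g b a)) :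
    ∑ g, ν g * F g = meetProb ν a b * (H a a + H b b) +
      (1 / 2 - meetProb ν a b) * (H a b + H b a) := by
  have e₀ := hν.sum_one
  have e₁ := hν.left a b hab
  have e₂ := hν.right b a hab.symm
  have key : ∑ g, ν g * F g =
      meetProb ν a b * H a a
      + (∑ g, ν g * (if ap2 g a b = a then 1 else 0) - meetProb ν a b) * H a b
      + (∑ g, ν g * (if ap2 g b a = a then 1 else 0) - meetProb ν a b) * H b a
      + (∑ g, ν g - ∑ g, ν g * (if ap2 g a b = a then 1 else 0)
        - ∑ g, ν g * (if ap2 g b a = a then 1 else 0) + meetProb ν a b) * H b b := by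
    simp only [meetProb, ← Finset.sum_sub_distrib, ← Finset.sum_add_distrib, Finset.sum_mul]
    refine Finset.sum_congr rfl fun g _ => ?_
    by_cases h0 : ν g = 0
    · simp [h0]
    have hg := hν.support_mem g h0
    rw [hF g hg]
    rcases hC.ap2_eq_or hg a b with h | h <;> rcases hC.ap2_eq_or hg b a with h' | h' <;>
      simp [h, h', hab.symm]
  rw [key, e₀, e₁, e₂]
  ring

lemma IsFairLaw.meetProb_pos (hC : IsBalancedClone C) {ν : Op D 2 → ℝ} (hν : IsFairLaw C ν)
    {a b : D} (hab : a ≠ b) {f : Op D 2} (hf : 0 < ν f) (hfab : ap2 f a b = ap2 f b a) :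
    0 < meetProb ν a b := by
  have hdual : meetProb ν a b =
      ∑ g, ν g * ((if ap2 g a b = b then 1 else 0) * (if ap2 g b a = b then 1 else 0)) := by
    rw [hν.sum_mul_apply hC hab _ (fun r s => (if r = b then 1 else 0) * (if s = b then 1 else 0))
      fun _ _ => rfl]
    simp [hab]
  rcases hC.ap2_eq_or (hν.support_mem f hf.ne') a b with h | h
  · refine Finset.sum_pos' (fun g _ => ?_) ⟨f, Finset.mem_univ f, ?_⟩
    · have := hν.nonneg g
      positivity
    · simp [← hfab, h, hf]
  · rw [hdual]
    refine Finset.sum_pos' (fun g _ => ?_) ⟨f, Finset.mem_univ f, ?_⟩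
    · have := hν.nonneg g
      positivity
    · simp [← hfab, h, hf]

lemma valueProb_amplifyLaw (hC : IsBalancedClone C) {ν : Op D 2 → ℝ} (hν : IsFairLaw C ν)
    {μ : Op D 3 → ℝ} (hμ : IsLaw C μ) {a b : D} (hab : a ≠ b) {u : Fin 3 → D}
    (hu : ∀ i, u i = a ∨ u i = b) :
    valueProb (amplifyLaw ν μ) u a = valueProb μ u a + meetProb ν a b ^ 2 *
      (valueProb μ u a * (1 - valueProb μ u a) * (2 * valueProb μ u a - 1)) := by
  have hu' : ∀ g ∈ C 3, g u = a ∨ g u = b := by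
    intro g hg
    obtain ⟨i, hi⟩ := hC.conservative hg u
    rw [hi]
    exact hu i
  have E := hμ.sum_mul_apply hab hu'
  set p := valueProb μ u a with hp
  set c := meetProb ν a b with hc
  let φ : Op D 2 → Op D 2 → D → D → D → ℝ := fun v w x y z =>
    if ap2 v (ap2 v (ap2 w x y) (ap2 w x z)) (ap2 w y z) = a then 1 else 0
  have E₃ : ∀ F : D → D → D → ℝ,
      ∑ g₀, μ g₀ * ∑ g₁, μ g₁ * ∑ g₂, μ g₂ * F (g₀ u) (g₁ u) (g₂ u) =
        p * (p * (p * F a a a + (1 - p) * F a a b) +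
          (1 - p) * (p * F a b a + (1 - p) * F a b b)) +
        (1 - p) * (p * (p * F b a a + (1 - p) * F b a b) +
          (1 - p) * (p * F b b a + (1 - p) * F b b b)) := by
    intro F
    simp_rw [fun x y => E (F x y)]
    simp_rw [fun x => E fun y => p * F x y a + (1 - p) * F x y b]
    rw [E fun x => p * (p * F x a a + (1 - p) * F x a b) +
          (1 - p) * (p * F x b a + (1 - p) * F x b b)]
  have step : valueProb (amplifyLaw ν μ) u a =
      ∑ v, ν v * ∑ w, ν w * ∑ g₀, μ g₀ * ∑ g₁, μ g₁ * ∑ g₂, μ g₂ *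
        φ v w (g₀ u) (g₁ u) (g₂ u) :=
    sum_amplifyLaw_mul ν μ fun h => if h u = a then 1 else 0
  simp_rw [step, fun v w => E₃ (φ v w)]
  let χ : D → ℝ := fun d => if d = a then 1 else 0
  have hχa : χ a = 1 := by simp [χ]
  have hχb : χ b = 0 := by simp [χ, hab.symm]
  have inner : ∀ v, _ := fun v => hν.sum_mul_apply hC hab
    (fun w => p * (p * (p * φ v w a a a + (1 - p) * φ v w a a b) +
          (1 - p) * (p * φ v w a b a + (1 - p) * φ v w a b b)) +
        (1 - p) * (p * (p * φ v w b a a + (1 - p) * φ v w b a b) +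
          (1 - p) * (p * φ v w b b a + (1 - p) * φ v w b b b)))
    (fun r s => p * (p * (p * χ (ap2 v (ap2 v a a) a) + (1 - p) * χ (ap2 v (ap2 v a r) r)) +
          (1 - p) * (p * χ (ap2 v (ap2 v r a) s) + (1 - p) * χ (ap2 v (ap2 v r r) b))) +
        (1 - p) * (p * (p * χ (ap2 v (ap2 v s s) a) + (1 - p) * χ (ap2 v (ap2 v s b) r)) +
          (1 - p) * (p * χ (ap2 v (ap2 v b s) s) + (1 - p) * χ (ap2 v (ap2 v b b) b))))
    (fun w hw => by simp only [φ, χ, hC.ap2_self hw])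
  simp_rw [inner]
  rw [hν.sum_mul_apply hC hab _ (fun r s =>
      χ r * χ s * (c * (1 - (1 - p) ^ 3 + (3 * p ^ 2 - 2 * p ^ 3)) + (1 - 2 * c) * (2 * p - p ^ 2))
      + (1 - χ r) * (1 - χ s) *
        (c * (p ^ 3 + (3 * p ^ 2 - 2 * p ^ 3)) + (1 - 2 * c) * p ^ 2)
      + (χ r * (1 - χ s) + (1 - χ r) * χ s) * p)]
  · simp only [hχa, hχb, ← hc]
    ring
  · intro v hv
    have ia := hC.ap2_self hv a
    have ib := hC.ap2_self hv b
    rcases hC.ap2_eq_or hv a b with h | h <;> rcases hC.ap2_eq_or hv b a with h' | h' <;>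
      simp only [h, h', ia, ib, hχa, hχb, ← hc] <;> ring

/-- The law with density `(ω + M (1_{π₀} + 1_{π₁})) / 2M` is fair for a balanced `ω`. -/
lemma IsBalancedClone.exists_isFairLaw (hC : IsBalancedClone C) {a b : D} (hab : a ≠ b)
    {f : Op D 2} (hf : f ∈ C 2) (hfab : ap2 f a b = ap2 f b a) :
    ∃ ν, IsFairLaw C ν ∧ 0 < ν f := by
  have hproj : ¬ IsProj f := by
    rintro ⟨i, rfl⟩
    fin_cases i
    · exact hab hfab
    · exact hab hfab.symm
  obtain ⟨ω, hω, hpos, hbal⟩ := hC.exists_balanced hf hproj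
  have hbal' : ∀ (x y z : D), ∑ g, (ω g : ℝ) * (if ap2 g x y = z then 1 else 0) = 0 := by
    intro x y z
    have h : ∑ g, ω g * (if ap2 g x y = z then 1 else 0) = 0 := hbal ![x, y] z
    simpa [apply_ite (Rat.cast : ℚ → ℝ)] using congrArg (Rat.cast : ℚ → ℝ) h
  have hsum : ∑ g, (ω g : ℝ) = 0 := by exact_mod_cast hω.sum_zero
  set M : ℝ := |(ω (proj D 0) : ℝ)| + |(ω (proj D 1) : ℝ)| + 1 with hM
  have hM0 : 0 < M := by positivity
  let δ : Op D 2 → ℝ := fun g =>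
    (if g = proj D 0 then 1 else 0) + (if g = proj D 1 then 1 else 0)
  have hδ : ∀ F : Op D 2 → ℝ, ∑ g, δ g * F g = F (proj D 0) + F (proj D 1) := by
    intro F
    simp [δ, add_mul, Finset.sum_add_distrib]
  have hδ0 : ∀ g, 0 ≤ δ g := fun g => by
    simp only [δ]
    positivity
  have hsplit : ∀ F : Op D 2 → ℝ, ∑ g, ((ω g : ℝ) + M * δ g) / (2 * M) * F g =
      (∑ g, (ω g : ℝ) * F g) / (2 * M) + (F (proj D 0) + F (proj D 1)) / 2 := by
    intro F
    rw [← hδ, Finset.sum_div, Finset.sum_div, ← Finset.sum_add_distrib]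
    refine Finset.sum_congr rfl fun g _ => ?_
    field_simp
  refine ⟨fun g => ((ω g : ℝ) + M * δ g) / (2 * M), ⟨⟨fun g => ?_, ?_, fun g hg => ?_⟩,
    fun x y hxy => ?_, fun x y hxy => ?_⟩, ?_⟩
  · refine div_nonneg ?_ (by positivity)
    by_cases hg : 0 ≤ ω g
    · have := hδ0 g
      positivity
    · have h1 : 1 ≤ δ g ∧ -M ≤ ω g := by
        obtain ⟨i, rfl⟩ := hω.neg_imp_proj g (not_le.mp hg)
        have n₀ := neg_abs_le (ω (proj D 0) : ℝ)
        have n₁ := neg_abs_le (ω (proj D 1) : ℝ)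
        have a₀ := abs_nonneg (ω (proj D 0) : ℝ)
        have a₁ := abs_nonneg (ω (proj D 1) : ℝ)
        fin_cases i
        · refine ⟨?_, by simp only [Fin.zero_eta]; linarith⟩
          simp only [δ, Fin.zero_eta, if_true]
          split_ifs <;> norm_num
        · refine ⟨?_, by simp only [Fin.mk_one]; linarith⟩
          simp only [δ, Fin.mk_one, if_true]
          split_ifs <;> norm_num
      nlinarith [h1.1, h1.2]
  · simpa [hsum] using hsplit fun _ => 1
  · by_contra hmem
    refine hg ?_
    have h0 : ω g = 0 := by
      by_contra h
      exact hmem (hω.support_mem g h)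
    have h1 : g ≠ proj D 0 := fun h => hmem (h ▸ hC.proj_mem 2 0)
    have h2 : g ≠ proj D 1 := fun h => hmem (h ▸ hC.proj_mem 2 1)
    simp [δ, h0, h1, h2]
  · rw [hsplit, hbal']
    simp [ap2, proj, hxy.symm]
  · rw [hsplit, hbal']
    simp [ap2, proj, hxy]
  · have h1 : (0 : ℝ) < ω f := by exact_mod_cast hpos
    have h2 := hδ0 f
    positivity

/-- Some ternary operation is a majority on all pairs with a commuting binary operation. -/
lemma IsBalancedClone.exists_majorityAt_commutesAt (hC : IsBalancedClone C) :
    ∃ m ∈ C 3, ∀ a b, a ≠ b → CommutesAt C a b → MajorityAt a b m := by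
  let K : Set (Op D 3 → ℝ) := {μ | IsLaw C μ ∧
    ∀ a b : D, a ≠ b → ∀ j, 2 / 3 ≤ valueProb μ (nearConst a b j) a}
  have hcont : ∀ u a, Continuous fun μ : Op D 3 → ℝ => valueProb μ u a := by
    intro u a
    unfold valueProb
    fun_prop
  have hK : IsCompact K := by
    have hclosed : IsClosed ({μ : Op D 3 → ℝ | ∀ g, g ∉ C 3 → μ g = 0} ∩
        {μ | ∀ a b : D, a ≠ b → ∀ j, 2 / 3 ≤ valueProb μ (nearConst a b j) a}) := by
      refine IsClosed.inter ?_ ?_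
      · simp only [Set.ofPred_forall]
        exact isClosed_iInter fun g => isClosed_iInter fun _ =>
          isClosed_eq (continuous_apply g) continuous_const
      · simp only [Set.ofPred_forall]
        exact isClosed_iInter fun a => isClosed_iInter fun b => isClosed_iInter fun _ =>
          isClosed_iInter fun j => isClosed_le continuous_const (hcont _ _)
    convert (isCompact_stdSimplex ℝ (Op D 3)).inter_right hclosed using 1
    ext μ
    constructor
    · rintro ⟨h, h'⟩
      exact ⟨⟨h.nonneg, h.sum_one⟩,
        fun g hg => by_contra fun hne => hg (h.support_mem g hne), h'⟩
    · rintro ⟨⟨h₁, h₂⟩, h₃, h'⟩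
      exact ⟨⟨h₁, h₂, fun g hg => by_contra fun hne => hg (h₃ g hne)⟩, h'⟩
  have hne : K.Nonempty := by
    let μ : Op D 3 → ℝ := fun g => (1 / 3) * ∑ i : Fin 3, if g = proj D i then 1 else 0
    have hsum : ∀ F : Op D 3 → ℝ, ∑ g, μ g * F g = (1 / 3) * ∑ i : Fin 3, F (proj D i) := by
      intro F
      simp only [μ, mul_assoc, ← Finset.mul_sum, Finset.sum_mul]
      rw [Finset.sum_comm]
      simp
    refine ⟨μ, ⟨fun g => by positivity, ?_, fun g hg => ?_⟩, fun a b hab j => ?_⟩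
    · simpa using hsum fun _ => 1
    · by_contra hmem
      refine hg ?_
      have : ∀ i, g ≠ proj D i := fun i h => hmem (h ▸ hC.proj_mem 3 i)
      simp [μ, this]
    · rw [valueProb, hsum]
      fin_cases j <;> simp [Fin.sum_univ_succ, proj, nearConst, hab.symm] <;> norm_num
  let Φ : (Op D 3 → ℝ) → ℝ := fun μ =>
    ∑ q : (D × D) × Fin 3, if q.1.1 ≠ q.1.2 then valueProb μ (nearConst q.1.1 q.1.2 q.2) q.1.1
      else 0
  have hΦ : Continuous Φ := by
    refine continuous_finsetSum _ fun q _ => ?_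
    split_ifs
    · exact hcont _ _
    · exact continuous_const
  obtain ⟨μ, ⟨hμ, hμ'⟩, hmax⟩ := hK.exists_isMaxOn hne hΦ.continuousOn
  have hle : ∀ {g : Op D 3} (u a), 0 ≤ μ g * (1 - if g u = a then 1 else 0) := by
    intro g u a
    refine mul_nonneg (hμ.nonneg g) ?_
    split_ifs <;> norm_num
  have hcompl : ∀ u a, ∑ g, μ g * (1 - if g u = a then 1 else 0) = 1 - valueProb μ u a := by
    intro u a
    simp only [mul_sub, mul_one, Finset.sum_sub_distrib, hμ.sum_one, valueProb]
  have hle1 : ∀ u a, valueProb μ u a ≤ 1 := fun u a =>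
    sub_nonneg.mp (hcompl u a ▸ Finset.sum_nonneg fun g _ => hle u a)
  have hone : ∀ a b, a ≠ b → CommutesAt C a b → ∀ j, valueProb μ (nearConst a b j) a = 1 := by
    rintro a b hab ⟨f, hf, hfab⟩ j
    obtain ⟨ν, hν, hνf⟩ := hC.exists_isFairLaw hab hf hfab
    have hform : ∀ x y : D, x ≠ y → ∀ i, _ := fun x y hxy i =>
      valueProb_amplifyLaw hC hν hμ hxy (u := nearConst x y i) fun l => by
        by_cases hl : l = i <;> simp [nearConst, hl]
    have hmono : ∀ x y : D, x ≠ y → ∀ i,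
        valueProb μ (nearConst x y i) x ≤ valueProb (amplifyLaw ν μ) (nearConst x y i) x := by
      intro x y hxy i
      rw [hform x y hxy i]
      have h₁ := hμ' x y hxy i
      have h₂ := hle1 (nearConst x y i) x
      exact le_add_of_nonneg_right (mul_nonneg (sq_nonneg _)
        (mul_nonneg (mul_nonneg (by linarith) (by linarith)) (by linarith)))
    have hmem : amplifyLaw ν μ ∈ K :=
      ⟨hν.toIsLaw.amplify hC.toIsClone hμ, fun x y hxy i => (hμ' x y hxy i).trans (hmono x y hxy i)⟩
    by_contra hne1
    have hlt : valueProb μ (nearConst a b j) a < 1 := lt_of_le_of_ne (hle1 _ _) hne1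
    have hΦle : Φ (amplifyLaw ν μ) ≤ Φ μ := hmax hmem
    refine absurd hΦle (not_le.mpr ?_)
    refine Finset.sum_lt_sum (fun q _ => ?_) ⟨((a, b), j), Finset.mem_univ _, ?_⟩
    · split_ifs with h
      · exact hmono _ _ h _
      · exact le_rfl
    · simp only [ne_eq, hab, not_false_eq_true, if_true]
      rw [hform a b hab j]
      have h₁ := hμ' a b hab j
      have h₂ := hν.meetProb_pos hC hab hνf hfab
      exact lt_add_of_pos_right _ (mul_pos (pow_pos h₂ 2)
        (mul_pos (mul_pos (by linarith) (by linarith)) (by linarith)))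
  obtain ⟨m, -, hm⟩ := Finset.exists_ne_zero_of_sum_ne_zero (hμ.sum_one.trans_ne one_ne_zero)
  refine ⟨m, hμ.support_mem m hm, fun a b hab hcomm => majorityAt_iff.mpr fun j => ?_⟩
  have h0 : ∑ g, μ g * (1 - if g (nearConst a b j) = a then 1 else 0) = 0 := by
    rw [hcompl, hone a b hab hcomm j, sub_self]
  have := (Finset.sum_eq_zero_iff_of_nonneg fun g _ => hle _ _).mp h0 m (Finset.mem_univ m)
  by_contra hmj
  simp [hmj, hm] at this

end Amplification

/-- If `Γ` contains all unary cost functions and `Pol⁺(Γ)` contains an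
idempotent cyclic operation, then `Pol⁺(Γ)` contains a majority operation. -/
theorem polPlus_majority {D : Type} [Fintype D] [DecidableEq D] [Nonempty D]
    (Γ : VLang D)
    (hall : ∀ ϱ : CostF D 1, (⟨1, ϱ⟩ : Σ r : ℕ, CostF D r) ∈ Γ)
    (hcyc : ∃ k : ℕ, 1 < k ∧ ∃ f ∈ PolPlus Γ k, Idem f ∧ CyclicOp f) :
    ∃ m ∈ PolPlus Γ 3, ∀ x y : D,
      ap3 m x x y = x ∧ ap3 m x y x = x ∧ ap3 m y x x = x := by
  have hC := isBalancedClone_PolPlus hall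
  obtain ⟨k, hk, f, hf, -, hfc⟩ := hcyc
  obtain ⟨m₀, hm₀, hcomm⟩ := hC.exists_majorityAt_commutesAt
  obtain ⟨m, hm, hmaj⟩ := hC.exists_majority hk hf hfc hm₀ hcomm
  refine ⟨m, hm, fun x y => ?_⟩
  rcases eq_or_ne x y with rfl | hxy
  · simp [hC.ap3_self hm]
  · exact hmaj x y hxy
end

section
/- Let Γ be a valued constraint language over a finite set D that is a core (every operation in fPol₁⁺(Γ) is bijective). If for every finite sublanguage Γ' ⊆ Γ the clone fPol⁺(Γ') contains a Taylor operation, then fPol⁺(Γ) contains a Taylor operation. -/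
namespace VCSP

/-! ### Idempotent clones without Taylor operations -/

/-- `f` preserves `B` and acts on it as a projection modulo the predicate `χ`. -/
def ActsAsProj {D : Type} (B : Set D) (χ : D → Prop) {ι : Type} (f : (ι → D) → D) : Prop :=
  ∃ i, ∀ b : ι → D, (∀ l, b l ∈ B) → f b ∈ B ∧ (χ (f b) ↔ χ (b i))

/-- The predicate `χ` takes both truth values on `B`. -/
def Splits {D : Type} (B : Set D) (χ : D → Prop) : Prop :=
  (∃ c ∈ B, ¬ χ c) ∧ ∃ c ∈ B, χ c

/-- Membership in `C` of an operation whose arguments are indexed by a finite type. -/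
def IndexedMem {D : Type} (C : ∀ k, Set (Op D k)) {ι : Type} [Fintype ι]
    (f : (ι → D) → D) : Prop :=
  (fun x : Fin (Fintype.card ι) → D => f fun i => x (Fintype.equivFin ι i)) ∈
    C (Fintype.card ι)

/-- The `N`-fold star power of `t`. -/
def starPower {D : Type} {k : ℕ} (t : Op D k) : ∀ N : ℕ, ((Fin N → Fin k) → D) → D
  | 0, x => x Fin.elim0
  | N + 1, x => t fun i => starPower t N fun s => x (Fin.cons i s)

section Clone

variable {D : Type} {C : ∀ k, Set (Op D k)}

theorem minor_mem (hC : IsClone C) {k l : ℕ} {f : Op D k} (hf : f ∈ C k)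
    (a : Fin k → Fin l) : (fun x : Fin l → D => f fun i => x (a i)) ∈ C l :=
  hC.superpose_mem k l f (fun i => proj D (a i)) hf fun i => hC.proj_mem l (a i)

theorem indexedMem_fin (hC : IsClone C) {k : ℕ} {f : Op D k} (hf : f ∈ C k) :
    IndexedMem C f :=
  minor_mem hC hf _

theorem indexedMem_proj (hC : IsClone C) {ι : Type} [Fintype ι] (i : ι) :
    IndexedMem C fun x : ι → D => x i :=
  hC.proj_mem _ (Fintype.equivFin ι i)

theorem indexedMem_superpose (hC : IsClone C) {ι κ : Type} [Fintype ι] [Fintype κ]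
    {f : (ι → D) → D} {g : ι → (κ → D) → D} (hf : IndexedMem C f)
    (hg : ∀ i, IndexedMem C (g i)) : IndexedMem C fun x => f fun i => g i x := by
  have h := hC.superpose_mem _ _ _
    (fun j (x : Fin (Fintype.card κ) → D) =>
      g ((Fintype.equivFin ι).symm j) fun i => x (Fintype.equivFin κ i)) hf fun j => hg _
  have heq : (fun x : Fin (Fintype.card κ) → D =>
      f fun j => g j fun i => x (Fintype.equivFin κ i)) =
      superposeOp (fun x => f fun i => x (Fintype.equivFin ι i)) fun j x =>
        g ((Fintype.equivFin ι).symm j) fun i => x (Fintype.equivFin κ i) := by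
    funext x
    simp only [superposeOp, Equiv.symm_apply_apply]
  unfold IndexedMem
  rw [heq]
  exact h

theorem starPower_mem (hC : IsClone C) {k : ℕ} {t : Op D k} (ht : t ∈ C k) (N : ℕ) :
    IndexedMem C (starPower t N) := by
  induction N with
  | zero => exact indexedMem_proj hC _
  | succ N ih =>
    refine indexedMem_superpose hC (ι := Fin k) (indexedMem_fin hC ht)
      (g := fun i x => starPower t N fun s => x (Fin.cons (α := fun _ => Fin k) i s)) fun i => ?_
    exact indexedMem_superpose hC ih
      (g := fun (s : Fin N → Fin k) (x : (Fin (N + 1) → Fin k) → D) =>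
        x (Fin.cons (α := fun _ => Fin k) i s)) fun s => indexedMem_proj hC _

theorem starPower_const {k : ℕ} {t : Op D k} (ht : Idem t) (N : ℕ) (d : D) :
    starPower t N (fun _ => d) = d := by
  induction N with
  | zero => rfl
  | succ N ih => simp only [starPower, ih]; exact ht d

theorem starPower_single {k : ℕ} {t : Op D k} (ht : Idem t) {N : ℕ} (p : Fin N)
    (v : Fin k → D) : starPower t N (fun s => v (s p)) = t v := by
  induction N with
  | zero => exact p.elim0
  | succ N ih =>
    refine Fin.cases ?_ (fun p => ?_) p
    · simp only [starPower, Fin.cons_zero, starPower_const ht]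
    · simp only [starPower, Fin.cons_succ, ih]; exact ht _

theorem starPower_pair {k : ℕ} {t : Op D k} (ht : Idem t) {N : ℕ} {p q : Fin N} (hpq : p < q)
    (v : Fin k → Fin k → D) :
    starPower t N (fun s => v (s p) (s q)) = t fun i => t fun j => v i j := by
  induction N with
  | zero => exact p.elim0
  | succ N ih =>
    obtain ⟨q, rfl⟩ := Fin.exists_succ_eq.2 (Fin.ne_zero_of_lt hpq)
    induction p using Fin.cases with
    | zero => simp only [starPower, Fin.cons_zero, Fin.cons_succ, starPower_single ht]
    | succ p =>
      simp only [starPower, Fin.cons_succ, ih (Fin.succ_lt_succ_iff.1 hpq)]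
      exact ht _

/-- If `C` has no Taylor operation, each idempotent member has a coordinate violating the
Taylor condition. -/
theorem exists_rigid_coordinate (hno : ∀ k, ∀ t ∈ C k, ¬ IsTaylor t) {ι : Type} [Fintype ι]
    {f : (ι → D) → D} (hf : IndexedMem C f) (hid : ∀ d, (f fun _ => d) = d) :
    ∃ j, ∀ a b : ι → Fin 2, (∀ u : Fin 2 → D, (f fun i => u (a i)) = f fun i => u (b i)) →
      a j = 0 → b j ≠ 1 := by
  by_contra! hcon
  refine hno _ _ hf ⟨hid, fun j => ?_⟩
  obtain ⟨a, b, hab, ha, hb⟩ := hcon ((Fintype.equivFin ι).symm j)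
  exact ⟨fun i => a ((Fintype.equivFin ι).symm i), fun i => b ((Fintype.equivFin ι).symm i),
    ha, hb, fun u => by simpa using hab u⟩

/-- For a member `t` of an idempotent clone without Taylor operations, some diagonal coordinate
of the star square of `t` is determined by any minor. -/
theorem exists_diagonal_coordinate (hC : IsClone C) (hno : ∀ k, ∀ t ∈ C k, ¬ IsTaylor t)
    {k : ℕ} {t : Op D k} (ht : t ∈ C k) (hid : Idem t) :
    ∃ i, ∀ (V : Type) (c c' : Fin k → Fin k → V),
      (∀ x : V → D, (t fun i => t fun j => x (c i j)) = t fun i => t fun j => x (c' i j)) →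
      c i i = c' i i := by
  classical
  obtain ⟨s, hs⟩ := exists_rigid_coordinate hno (starPower_mem hC ht (k + 1))
    (starPower_const hid _)
  obtain ⟨p, q, hpq, hs'⟩ := Fintype.exists_ne_map_eq_of_card_lt s (by simp)
  wlog hlt : p < q generalizing p q
  · exact this q p hpq.symm hs'.symm (lt_of_le_of_ne (not_lt.1 hlt) hpq.symm)
  refine ⟨s p, fun V c c' hcc => ?_⟩
  by_contra hne
  let h : V → Fin 2 := fun v => if v = c (s p) (s p) then 0 else 1
  refine hs (fun r => h (c (r p) (r q))) (fun r => h (c' (r p) (r q))) (fun u => ?_) ?_ ?_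
  · rw [starPower_pair hid hlt fun i j => u (h (c i j)),
      starPower_pair hid hlt fun i j => u (h (c' i j))]
    exact hcc fun v => u (h v)
  · simp [h, ← hs']
  · simp [h, ← hs', Ne.symm hne]

theorem exists_common_major (hC : IsClone C) (hid : ∀ k, ∀ f ∈ C k, Idem f) {n : ℕ}
    (S : Finset (Op D n)) (hS : ∀ f ∈ S, f ∈ C n) :
    ∃ (k : ℕ) (t : Op D k), t ∈ C k ∧
      ∀ f ∈ S, ∃ a : Fin k → Fin n, ∀ x, f x = t fun i => x (a i) := by
  classical
  induction S using Finset.induction_on with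
  | empty => exact ⟨1, proj D 0, hC.proj_mem _ _, by simp⟩
  | insert f S hf ih =>
    obtain ⟨k, t, ht, hmin⟩ := ih fun g hg => hS g (Finset.mem_insert_of_mem hg)
    have hfC := hS f (Finset.mem_insert_self f S)
    let T : (Fin k × Fin n → D) → D := fun x => t fun i => f fun j => x (i, j)
    have hT : IndexedMem C T :=
      indexedMem_superpose hC (indexedMem_fin hC ht) (g := fun i x => f fun j => x (i, j))
        fun i => indexedMem_superpose hC (indexedMem_fin hC hfC)
          (g := fun j x => x (i, j)) fun j => indexedMem_proj hC _
    have hT' : ∀ g : Op D n, (∃ a : Fin k × Fin n → Fin n, ∀ x, g x = T fun i => x (a i)) →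
        ∃ a : Fin (Fintype.card (Fin k × Fin n)) → Fin n, ∀ x,
          g x = (fun x : Fin (Fintype.card (Fin k × Fin n)) → D =>
            T fun i => x (Fintype.equivFin _ i)) fun i => x (a i) := by
      rintro g ⟨a, ha⟩
      exact ⟨fun i => a ((Fintype.equivFin _).symm i), fun x => by simpa using ha x⟩
    refine ⟨_, _, hT, fun g hg => hT' g ?_⟩
    rcases Finset.mem_insert.1 hg with rfl | hg
    · exact ⟨fun p => p.2, fun x => (hid k t ht _).symm⟩
    · obtain ⟨a, ha⟩ := hmin g hg
      refine ⟨fun p => a p.1, fun x => ?_⟩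
      rw [ha x]
      exact congrArg t (funext fun i => (hid n f hfC _).symm)

/-- A subpower with a two-valued quotient on which idempotent operations act as projections
yields such a subset of the base set. -/
theorem exists_splits_of_subpower {X : Type} [Finite X] {n : ℕ} {E : Set (Op D n)}
    (hid : ∀ g ∈ E, Idem g) {B : Set (X → D)} {χ : (X → D) → Prop} (hB : Splits B χ)
    (hE : ∀ g ∈ E, ActsAsProj B χ fun b : Fin n → X → D => fun x => g fun i => b i x) :
    ∃ (B' : Set D) (χ' : D → Prop), Splits B' χ' ∧ ∀ g ∈ E, ActsAsProj B' χ' g := by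
  classical
  obtain ⟨⟨c₀, hc₀, hχ₀⟩, c₁, hc₁, hχ₁⟩ := hB
  obtain ⟨S, ⟨b, hb, b', hb', hbb', hχb, hχb'⟩, hmax⟩ := Set.Finite.exists_maximal
    (s := {S : Set X | ∃ b ∈ B, ∃ b' ∈ B, (∀ s ∈ S, b' s = b s) ∧ χ b ∧ ¬ χ b'})
    (Set.toFinite _) ⟨∅, c₁, hc₁, c₀, hc₀, by simp, hχ₁, hχ₀⟩
  obtain ⟨x, hx⟩ : ∃ x, x ∉ S := by
    by_contra! hS
    exact hχb' ((funext fun s => hbb' s (hS s) : b' = b) ▸ hχb)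
  let B₀ : Set (X → D) := {c | c ∈ B ∧ ∀ s ∈ S, c s = b s}
  have key : ∀ c ∈ B₀, ∀ c' ∈ B₀, c x = c' x → χ c → χ c' := by
    intro c hc c' hc' hcc hχ
    by_contra hχ'
    refine hx (hmax (y := insert x S) ⟨c, hc.1, c', hc'.1, ?_, hχ, hχ'⟩
      (Set.subset_insert x S) (Set.mem_insert x S))
    rintro s (rfl | hs)
    · exact hcc.symm
    · rw [hc.2 s hs, hc'.2 s hs]
  have hiff : ∀ c ∈ B₀, ((∃ c' ∈ B₀, c' x = c x ∧ χ c') ↔ χ c) := fun c hc =>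
    ⟨fun ⟨c', hc', h, hχ⟩ => key c' hc' c hc h hχ, fun h => ⟨c, hc, rfl, h⟩⟩
  have hbB₀ : b ∈ B₀ := ⟨hb, fun _ _ => rfl⟩
  have hbB₀' : b' ∈ B₀ := ⟨hb', hbb'⟩
  refine ⟨{d | ∃ c ∈ B₀, c x = d}, fun d => ∃ c ∈ B₀, c x = d ∧ χ c,
    ⟨⟨b' x, ⟨b', hbB₀', rfl⟩, fun h => hχb' ((hiff b' hbB₀').1 h)⟩,
      b x, ⟨b, hbB₀, rfl⟩, (hiff b hbB₀).2 hχb⟩, fun g hg => ?_⟩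
  obtain ⟨i, hi⟩ := hE g hg
  refine ⟨i, fun d hd => ?_⟩
  choose c hc hcd using hd
  obtain ⟨h₁, h₂⟩ := hi c fun l => (hc l).1
  have hgc : (fun x => g fun i => c i x) ∈ B₀ := by
    refine ⟨h₁, fun s hs => ?_⟩
    simp only [fun i => (hc i).2 s hs]
    exact hid g hg _
  obtain rfl : (fun l => c l x) = d := funext hcd
  exact ⟨⟨_, hgc, rfl⟩, (hiff _ hgc).trans (h₂.trans (hiff _ (hc i)).symm)⟩

/-- An idempotent clone without Taylor operations acts, in each fixed arity, as a set of
projections on a two-valued quotient of a subset of the base set. -/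
theorem exists_splits_of_arity [Fintype D] (hC : IsClone C)
    (hid : ∀ k, ∀ f ∈ C k, Idem f) (hno : ∀ k, ∀ t ∈ C k, ¬ IsTaylor t) {n : ℕ} (hn : 2 ≤ n) :
    ∃ (B : Set D) (χ : D → Prop), Splits B χ ∧ ∀ f ∈ C n, ActsAsProj B χ f := by
  classical
  obtain ⟨k, t, ht, hmin⟩ := exists_common_major hC hid (Finset.univ.filter (· ∈ C n))
    (by simp)
  obtain ⟨i, hi⟩ := exists_diagonal_coordinate hC hno ht (hid k t ht)
  have hmin' : ∀ f : Op D n, ∃ a : Fin k → Fin n, f ∈ C n → ∀ x, f x = t fun i => x (a i) := by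
    intro f
    by_cases hf : f ∈ C n
    · obtain ⟨a, ha⟩ := hmin f (by simpa using hf)
      exact ⟨a, fun _ => ha⟩
    · exact ⟨fun _ => ⟨0, by omega⟩, fun h => absurd h hf⟩
  choose a ha using hmin'
  have hproj : ∀ j : Fin n, a (proj D j) i = j := fun j =>
    hi _ (fun p _ => a (proj D j) p) (fun _ _ => j) fun x => by
      have h : x j = _ := ha (proj D j) (hC.proj_mem _ _) x
      calc (t fun p => t fun _ => x (a (proj D j) p)) = t fun p => x (a (proj D j) p) :=
            congrArg t (funext fun p => hid k t ht _)
        _ = x j := h.symm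
        _ = t fun _ => t fun _ => x j := by rw [hid k t ht, hid k t ht]
  have hcomp : ∀ g ∈ C n, ∀ b : Fin n → Op D n, (∀ l, b l ∈ C n) →
      a (superposeOp g b) i = a (b (a g i)) i := by
    intro g hg b hb
    refine hi _ (fun p _ => a (superposeOp g b) p) (fun p q => a (b (a g p)) q) fun x => ?_
    have h₁ := ha _ (hC.superpose_mem _ _ g b hg hb) x
    calc (t fun p => t fun _ => x (a (superposeOp g b) p))
        = t fun p => x (a (superposeOp g b) p) :=
          congrArg t (funext fun p => hid k t ht _)
      _ = t fun p => b (a g p) x := by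
          rw [← h₁]
          exact ha g hg fun l => b l x
      _ = _ := congrArg t (funext fun p => ha _ (hb _) x)
  let z : Fin n := ⟨0, by omega⟩
  let o : Fin n := ⟨1, by omega⟩
  refine exists_splits_of_subpower (X := Fin n → D) (E := C n) (B := C n) (hid n)
    (χ := fun f => a f i = z)
    ⟨⟨proj D o, hC.proj_mem _ _, ?_⟩, proj D z, hC.proj_mem _ _, hproj z⟩ ?_
  · show ¬ a (proj D o) i = z
    rw [hproj]; simp [z, o]
  · exact fun g hg => ⟨a g i, fun b hb =>
      ⟨hC.superpose_mem _ _ g b hg hb, by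
        show a (superposeOp g b) i = z ↔ a (b (a g i)) i = z
        rw [hcomp g hg b hb]⟩⟩

/-- If the operations of a clone of arity `|D|³` act as projections on a two-valued quotient,
so do all operations of the clone. -/
theorem actsAsProj_of_arity_card_cube [Fintype D] (hC : IsClone C)
    {B : Set D} {χ : D → Prop} (hB : Splits B χ)
    (h : ∀ f ∈ C (Fintype.card (D × D × D)), ActsAsProj B χ f) {m : ℕ} {f : Op D m}
    (hf : f ∈ C m) : ActsAsProj B χ f := by
  classical
  obtain ⟨⟨c₀, hc₀, hχ₀⟩, c₁, hc₁, hχ₁⟩ := hB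
  have triple : ∀ b b' b'' : Fin m → D, (∀ l, b l ∈ B) → (∀ l, b' l ∈ B) → (∀ l, b'' l ∈ B) →
      ∃ l, f b ∈ B ∧ (χ (f b) ↔ χ (b l)) ∧ (χ (f b') ↔ χ (b' l)) ∧ (χ (f b'') ↔ χ (b'' l)) := by
    intro b b' b'' hb hb' hb''
    let e := Fintype.equivFin (D × D × D)
    let a : Fin m → Fin (Fintype.card (D × D × D)) := fun l => e (b l, b' l, b'' l)
    obtain ⟨i, hi⟩ := h _ (minor_mem hC hf a)
    have hval : ∀ (π : D × D × D → D) (c : D), c ∈ B → (∀ l, π (b l, b' l, b'' l) ∈ B) →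
        let x : Fin (Fintype.card (D × D × D)) → D :=
          fun j => if j ∈ Set.range a then π (e.symm j) else c
        f (fun l => π (b l, b' l, b'' l)) ∈ B ∧
          (χ (f fun l => π (b l, b' l, b'' l)) ↔ χ (x i)) := by
      intro π c hc hπ x
      have hx : (fun l => x (a l)) = fun l => π (b l, b' l, b'' l) := by
        funext l
        show (if a l ∈ Set.range a then _ else _) = _
        rw [if_pos (Set.mem_range_self l)]
        simp [a]
      have := hi x fun j => by
        by_cases hj : j ∈ Set.range a
        · obtain ⟨l, rfl⟩ := hj
          exact congrFun hx l ▸ hπ l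
        · show (if _ then _ else _) ∈ B
          rw [if_neg hj]
          exact hc
      simpa only [hx] using this
    have hia : i ∈ Set.range a := by
      by_contra hia
      have h₀ := (hval (fun p => p.1) c₀ hc₀ hb).2
      have h₁ := (hval (fun p => p.1) c₁ hc₁ hb).2
      simp only [hia, if_false] at h₀ h₁
      exact hχ₀ (h₀.1 (h₁.2 hχ₁))
    obtain ⟨l, rfl⟩ := hia
    refine ⟨l, (hval (fun p => p.1) c₀ hc₀ hb).1, ?_, ?_, ?_⟩
    · simpa only [Set.mem_range_self, if_true, a, Equiv.symm_apply_apply] using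
        (hval (fun p => p.1) c₀ hc₀ hb).2
    · simpa only [Set.mem_range_self, if_true, a, Equiv.symm_apply_apply] using
        (hval (fun p => p.2.1) c₀ hc₀ hb').2
    · simpa only [Set.mem_range_self, if_true, a, Equiv.symm_apply_apply] using
        (hval (fun p => p.2.2) c₀ hc₀ hb'').2
  let L : (Fin m → D) → Finset (Fin m) := fun b =>
    Finset.univ.filter fun l => (χ (f b) ↔ χ (b l))
  obtain ⟨b, hb, hmin⟩ := Set.exists_min_image {b : Fin m → D | ∀ l, b l ∈ B}
    (fun b => (L b).card) (Set.toFinite _) ⟨fun _ => c₀, fun _ => hc₀⟩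
  let ind : (Fin m → Prop) → Fin m → D := fun P l => if P l then c₁ else c₀
  have hind : ∀ P l, ind P l ∈ B := fun P l => by
    by_cases hP : P l <;> simp [ind, hP, hc₀, hc₁]
  have hχind : ∀ P l, χ (ind P l) ↔ P l := fun P l => by
    by_cases hP : P l <;> simp [ind, hP, hχ₀, hχ₁]
  obtain ⟨l, -, hl, -, -⟩ := triple b b b hb hb hb
  have hL : ∀ b r, r ∈ L b ↔ (χ (f b) ↔ χ (b r)) := fun b r => by simp [L]
  have hsingle : ∀ l' ∈ L b, l' = l := by
    intro l' hl'
    by_contra hne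
    obtain ⟨c, hcB, hχc⟩ : ∃ c : Fin m → D, (∀ r, c r ∈ B) ∧ ∀ r, χ (c r) ↔ r = l :=
      ⟨_, hind _, hχind _⟩
    obtain ⟨c', hcB', hχc'⟩ : ∃ c' : Fin m → D, (∀ r, c' r ∈ B) ∧
        ∀ r, χ (c' r) ↔ r ∈ L b ∧ r ∈ L c := ⟨_, hind _, hχind _⟩
    obtain ⟨l₀, -, h₀, h₀', h₀''⟩ := triple b c c' hb hcB hcB'
    have hf₁ : χ (f c') := h₀''.2 ((hχc' l₀).2 ⟨(hL _ _).2 h₀, (hL _ _).2 h₀'⟩)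
    have hmem : ∀ r ∈ L c', r ∈ L b ∧ r ∈ L c := fun r hr =>
      (hχc' r).1 (((hL _ _).1 hr).1 hf₁)
    refine absurd (hmin c' hcB') (not_le.2 (Finset.card_lt_card
      (Finset.ssubset_iff_subset_ne.2 ⟨fun r hr => (hmem r hr).1, fun heq => ?_⟩)))
    have hin : ∀ r ∈ L b, χ (f c) ↔ r = l := fun r hr =>
      ((hL _ _).1 (hmem r (heq ▸ hr)).2).trans (hχc r)
    exact hne ((hin l' hl').1 ((hin l ((hL _ _).2 hl)).2 rfl))
  refine ⟨l, fun b' hb' => ?_⟩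
  obtain ⟨r, hr, hr', hr'', -⟩ := triple b' b b' hb' hb hb'
  obtain rfl := hsingle r ((hL _ _).2 hr'')
  exact ⟨hr, hr'⟩

theorem not_isTaylor_of_actsAsProj {B : Set D} {χ : D → Prop} (hB : Splits B χ) {k : ℕ}
    {f : Op D k} (hf : ActsAsProj B χ f) : ¬ IsTaylor f := by
  rintro ⟨-, h⟩
  obtain ⟨⟨c₀, hc₀, hχ₀⟩, c₁, hc₁, hχ₁⟩ := hB
  obtain ⟨i, hi⟩ := hf
  obtain ⟨a, b, ha, hb, hab⟩ := h i
  have hu : ∀ s, (![c₀, c₁] : Fin 2 → D) s ∈ B := by simp [Fin.forall_fin_two, hc₀, hc₁]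
  have h₀ := (hi (fun l => ![c₀, c₁] (a l)) fun l => hu _).2
  have h₁ := (hi (fun l => ![c₀, c₁] (b l)) fun l => hu _).2
  rw [← hab] at h₁
  simp only [ha, hb] at h₀ h₁
  exact hχ₀ (h₀.1 (h₁.2 hχ₁))

end Clone

/-- In a finite colouring of a large enough box of dimension `k`, some subbox with sides of size
two is monochromatic. -/
theorem exists_monochromatic_subbox (κ : Type) [Finite κ] (k : ℕ) :
    ∃ N : ℕ, ∀ c : (Fin k → Fin N) → κ, ∃ P : Fin k → Fin 2 → Fin N,
      (∀ q, P q 0 ≠ P q 1) ∧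
        ∀ ε ε' : Fin k → Fin 2, c (fun q => P q (ε q)) = c fun q => P q (ε' q) := by
  classical
  induction k with
  | zero => exact ⟨0, fun c => ⟨fun q => q.elim0, fun q => q.elim0,
      fun ε ε' => congrArg c (Subsingleton.elim _ _)⟩⟩
  | succ k ih =>
    obtain ⟨N, hN⟩ := ih
    have := Fintype.ofFinite κ
    let N' := max N (Fintype.card ((Fin k → Fin N) → κ) + 1)
    refine ⟨N', fun c => ?_⟩
    let ι : Fin N → Fin N' := Fin.castLE (le_max_left _ _)
    obtain ⟨x, y, hxy, hc⟩ := Fintype.exists_ne_map_eq_of_card_lt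
      (fun (x : Fin N') (w : Fin k → Fin N) => c (Fin.cons x fun q => ι (w q)))
      (by rw [Fintype.card_fin]; exact lt_of_lt_of_le (Nat.lt_succ_self _) (le_max_right _ _))
    obtain ⟨P, hP, hmono⟩ := hN fun w => c (Fin.cons x fun q => ι (w q))
    let Q : Fin (k + 1) → Fin 2 → Fin N' := Fin.cons ![x, y] fun q s => ι (P q s)
    have hQ : ∀ ε : Fin (k + 1) → Fin 2, c (fun q => Q q (ε q)) =
        c (Fin.cons x fun q => ι (P q (ε q.succ))) := by
      intro ε
      have hcons : (fun q => Q q (ε q)) =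
          Fin.cons (![x, y] (ε 0)) fun q : Fin k => ι (P q (ε q.succ)) := by
        funext q
        induction q using Fin.cases <;> simp [Q]
      rw [hcons]
      rcases Fin.exists_fin_two.1 ⟨ε 0, rfl⟩ with h | h
      · rw [h]; rfl
      · rw [h]; exact (congrFun hc _).symm
    refine ⟨Q, fun q => ?_, fun ε ε' => ?_⟩
    · induction q using Fin.cases with
      | zero => simpa [Q] using hxy
      | succ q => simpa [Q, ι] using hP q
    · rw [hQ, hQ]
      exact hmono (fun q => ε q.succ) fun q => ε' q.succ

/-! ### Families of operations satisfying the fractional polymorphism inequality -/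

/-- The real value of a finite cost (`0` if the cost is infinite). -/
noncomputable def realCost (x : WithTop ℚ) : ℝ := ((x.untopD 0 : ℚ) : ℝ)

theorem rmul_eq_coe (c : ℝ) {x : WithTop ℚ} (hx : x ≠ ⊤) :
    rmul c x = ((c * realCost x : ℝ) : WithTop ℝ) := by
  lift x to ℚ using hx
  rfl

/-- The weights `w` form a probability distribution and the random operation `F` satisfies the
fractional polymorphism inequality for all cost functions of `Γ`. -/
structure IsFracFamily {D : Type} (Γ : VLang D) {m : ℕ} {Ω : Type} [Fintype Ω] (w : Ω → ℝ)
    (F : Ω → Op D m) : Prop where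
  nonneg : ∀ a, 0 ≤ w a
  sum_eq_one : ∑ a, w a = 1
  feas : ∀ ϱ ∈ Γ, ∀ xs : Fin m → Fin ϱ.1 → D, (∀ i, xs i ∈ Feas ϱ.2) →
    ∀ a, 0 < w a → appRows (F a) xs ∈ Feas ϱ.2
  le : ∀ ϱ ∈ Γ, ∀ xs : Fin m → Fin ϱ.1 → D, (∀ i, xs i ∈ Feas ϱ.2) →
    ∑ a, w a * realCost (ϱ.2 (appRows (F a) xs)) ≤ (∑ i, realCost (ϱ.2 (xs i))) / m

theorem Idem.arity_pos {D : Type} [Nontrivial D] {k : ℕ} {f : Op D k} (hf : Idem f) : 0 < k := by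
  rcases Nat.eq_zero_or_pos k with rfl | hk
  · obtain ⟨x, y, hxy⟩ := exists_pair_ne D
    exact absurd ((hf x).symm.trans ((congrArg f (Subsingleton.elim _ _)).trans (hf y))) hxy
  · exact hk

section Frac

variable {D : Type} [Fintype D] [DecidableEq D] {Γ : VLang D}

theorem sum_rmul_le_iff {m r : ℕ} {ω : Op D m → ℝ} (hω : ∀ g, 0 ≤ ω g) {ϱ : CostF D r}
    {xs : Fin m → Fin r → D} (hxs : ∀ i, xs i ∈ Feas ϱ) :
    (∑ g ∈ Finset.univ.filter fun g : Op D m => 0 < ω g, rmul (ω g) (ϱ (appRows g xs))) ≤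
        rmul (1 / (m : ℝ)) (∑ i : Fin m, ϱ (xs i)) ↔
      (∀ g, 0 < ω g → appRows g xs ∈ Feas ϱ) ∧
        ∑ g, ω g * realCost (ϱ (appRows g xs)) ≤ (∑ i, realCost (ϱ (xs i))) / m := by
  have hsum : ∑ i, ϱ (xs i) = ((∑ i, (ϱ (xs i)).untopD 0 : ℚ) : WithTop ℚ) := by
    rw [WithTop.coe_sum]
    refine Finset.sum_congr rfl fun i _ => ?_
    obtain ⟨q, hq⟩ := WithTop.ne_top_iff_exists.1 (hxs i)
    rw [← hq]
    rfl
  have hright : rmul (1 / (m : ℝ)) (∑ i : Fin m, ϱ (xs i)) =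
      (((∑ i, realCost (ϱ (xs i))) / m : ℝ) : WithTop ℝ) := by
    rw [hsum, rmul_eq_coe _ WithTop.coe_ne_top]
    congr 1
    simp only [realCost, WithTop.untopD_coe, Rat.cast_sum]
    ring
  by_cases hfeas : ∀ g, 0 < ω g → appRows g xs ∈ Feas ϱ
  · have hleft : (∑ g ∈ Finset.univ.filter fun g : Op D m => 0 < ω g,
        rmul (ω g) (ϱ (appRows g xs))) =
        ((∑ g, ω g * realCost (ϱ (appRows g xs)) : ℝ) : WithTop ℝ) := by
      rw [← Finset.sum_filter_of_ne (p := fun g => 0 < ω g)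
        fun g _ hg => (hω g).lt_of_ne' (left_ne_zero_of_mul hg), WithTop.coe_sum]
      exact Finset.sum_congr rfl fun g hg =>
        rmul_eq_coe _ (hfeas g ((Finset.mem_filter_univ g).1 hg))
    rw [hleft, hright, WithTop.coe_le_coe]
    exact ⟨fun h => ⟨hfeas, h⟩, fun h => h.2⟩
  · refine ⟨fun h => absurd (fun g hg hgx => ?_) hfeas, fun h => absurd h.1 hfeas⟩
    have hg' : rmul (ω g) (ϱ (appRows g xs)) = ⊤ := by rw [hgx]; rfl
    rw [hright, WithTop.sum_eq_top.2 ⟨g, (Finset.mem_filter_univ g).2 hg, hg'⟩] at h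
    exact WithTop.coe_ne_top (top_le_iff.1 h)

theorem isFracPolymorphism_iff {m : ℕ} {ω : Op D m → ℝ} :
    IsFracPolymorphism Γ ω ↔ IsFracFamily Γ ω id := by
  constructor
  · rintro ⟨⟨h₀, h₁⟩, h⟩
    exact ⟨h₀, h₁, fun ϱ hϱ xs hxs => ((sum_rmul_le_iff h₀ hxs).1 (h ϱ hϱ xs hxs)).1,
      fun ϱ hϱ xs hxs => ((sum_rmul_le_iff h₀ hxs).1 (h ϱ hϱ xs hxs)).2⟩
  · intro h
    exact ⟨⟨h.nonneg, h.sum_eq_one⟩, fun ϱ hϱ xs hxs =>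
      (sum_rmul_le_iff h.nonneg hxs).2 ⟨h.feas ϱ hϱ xs hxs, h.le ϱ hϱ xs hxs⟩⟩

theorem IsFracFamily.push {m : ℕ} {Ω : Type} [Fintype Ω] {w : Ω → ℝ}
    {F : Ω → Op D m} (h : IsFracFamily Γ w F) :
    IsFracFamily Γ (fun f => ∑ a with F a = f, w a) id where
  nonneg f := Finset.sum_nonneg fun a _ => h.nonneg a
  sum_eq_one := (Finset.sum_fiberwise _ _ _).trans h.sum_eq_one
  feas ϱ hϱ xs hxs f hf := by
    obtain ⟨a, ha, ha'⟩ := Finset.exists_lt_of_sum_lt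
      (f := fun _ => (0 : ℝ)) (by simpa using hf)
    obtain rfl := (Finset.mem_filter_univ a).1 ha
    exact h.feas ϱ hϱ xs hxs a ha'
  le ϱ hϱ xs hxs := by
    refine le_trans (le_of_eq ?_) (h.le ϱ hϱ xs hxs)
    rw [← Finset.sum_fiberwise Finset.univ F]
    refine Finset.sum_congr rfl fun f _ => ?_
    rw [Finset.sum_mul]
    refine Finset.sum_congr rfl fun a ha => ?_
    rw [(Finset.mem_filter_univ a).1 ha]
    rfl

theorem IsFracFamily.mem_fPolPlus {m : ℕ} {Ω : Type} [Fintype Ω] {w : Ω → ℝ}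
    {F : Ω → Op D m} (h : IsFracFamily Γ w F) {a : Ω} (ha : 0 < w a) :
    F a ∈ fPolPlus Γ m := by
  refine Or.inr ⟨_, isFracPolymorphism_iff.2 h.push, ?_⟩
  exact lt_of_lt_of_le ha (Finset.single_le_sum (f := w) (fun b _ => h.nonneg b) (by simp))

/-- The uniform distribution on the projections, as a distribution on operations. -/
noncomputable def projLaw (D : Type) [Fintype D] [DecidableEq D] (m : ℕ) : Op D m → ℝ :=
  fun f => ∑ i : Fin m with proj D i = f, 1 / (m : ℝ)

theorem isFracFamily_projLaw (Γ : VLang D) {m : ℕ} (hm : 0 < m) :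
    IsFracFamily Γ (projLaw D m) id := by
  have hm' : (m : ℝ) ≠ 0 := by exact_mod_cast hm.ne'
  refine IsFracFamily.push (F := fun i : Fin m => proj D i)
    ⟨fun _ => by positivity, by simp [hm'], fun ϱ _ xs hxs i _ => hxs i, fun ϱ _ xs _ => ?_⟩
  rw [← Finset.mul_sum, one_div_mul_eq_div]
  rfl

theorem isProj_of_projLaw_pos {m : ℕ} {f : Op D m} (hf : projLaw D m f ≠ 0) : IsProj f := by
  obtain ⟨i, hi, -⟩ := Finset.exists_ne_zero_of_sum_ne_zero hf
  exact ⟨i, ((Finset.mem_filter_univ i).1 hi).symm⟩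

theorem exists_law_of_mem_fPolPlus {m : ℕ} (hm : 0 < m) {f : Op D m} (hf : f ∈ fPolPlus Γ m) :
    ∃ ω : Op D m → ℝ, IsFracFamily Γ ω id ∧ 0 < ω f := by
  rcases hf with ⟨i, rfl⟩ | ⟨ω, hω, hf⟩
  · refine ⟨_, isFracFamily_projLaw Γ hm, ?_⟩
    have hm' : (0 : ℝ) < m := by exact_mod_cast hm
    exact Finset.sum_pos (fun _ _ => by positivity) ⟨i, by simp⟩
  · exact ⟨ω, isFracPolymorphism_iff.1 hω, hf⟩

theorem fPolPlus_anti {Γ' : VLang D} (hΓ : Γ' ⊆ Γ) (k : ℕ) : fPolPlus Γ k ⊆ fPolPlus Γ' k := by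
  rintro f (hf | ⟨ω, ⟨h₁, h₂⟩, hf⟩)
  · exact Or.inl hf
  · exact Or.inr ⟨ω, ⟨h₁, fun ϱ hϱ => h₂ ϱ (hΓ hϱ)⟩, hf⟩

/-- Substituting random operations whose average costs satisfy the fractional polymorphism
inequality into the operations of a random fractional polymorphism. -/
theorem IsFracFamily.bind {k l : ℕ} {Ψ : Type} [Fintype Ψ] {ν : Ψ → ℝ} (hν : ∀ ψ, 0 ≤ ν ψ)
    (hν' : ∑ ψ, ν ψ = 1) {W : Ψ → Op D k → ℝ} (hW : ∀ ψ, IsFracFamily Γ (W ψ) id)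
    {F : Ψ → Fin k → Op D l}
    (hfeas : ∀ ϱ ∈ Γ, ∀ xs : Fin l → Fin ϱ.1 → D, (∀ i, xs i ∈ Feas ϱ.2) →
      ∀ ψ, 0 < ν ψ → ∀ i, appRows (F ψ i) xs ∈ Feas ϱ.2)
    (hle : ∀ ϱ ∈ Γ, ∀ xs : Fin l → Fin ϱ.1 → D, (∀ i, xs i ∈ Feas ϱ.2) →
      ∑ ψ, ν ψ * ((∑ i, realCost (ϱ.2 (appRows (F ψ i) xs))) / k) ≤
        (∑ i, realCost (ϱ.2 (xs i))) / l) :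
    IsFracFamily Γ (fun p : Ψ × Op D k => ν p.1 * W p.1 p.2)
      (fun p => superposeOp p.2 (F p.1)) where
  nonneg p := mul_nonneg (hν _) ((hW _).nonneg _)
  sum_eq_one := by
    rw [Fintype.sum_prod_type]
    simp only [← Finset.mul_sum, (hW _).sum_eq_one, mul_one, hν']
  feas ϱ hϱ xs hxs p hp := by
    have h₁ : 0 < ν p.1 := (hν _).lt_of_ne' (left_ne_zero_of_mul hp.ne')
    have h₂ : 0 < W p.1 p.2 := ((hW _).nonneg _).lt_of_ne' (right_ne_zero_of_mul hp.ne')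
    exact (hW p.1).feas ϱ hϱ (fun i => appRows (F p.1 i) xs) (hfeas ϱ hϱ xs hxs p.1 h₁) p.2 h₂
  le ϱ hϱ xs hxs := by
    refine le_trans ?_ (hle ϱ hϱ xs hxs)
    rw [Fintype.sum_prod_type]
    refine Finset.sum_le_sum fun ψ _ => ?_
    simp only [mul_assoc]
    rw [← Finset.mul_sum]
    rcases (hν ψ).eq_or_lt with h₀ | h₀
    · simp [← h₀]
    · exact mul_le_mul_of_nonneg_left
        ((hW ψ).le ϱ hϱ (fun i => appRows (F ψ i) xs) (hfeas ϱ hϱ xs hxs ψ h₀)) (hν ψ)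

theorem sum_prod_mul_eval {κ α : Type} [Fintype κ] [DecidableEq κ] [Fintype α]
    {μ : κ → α → ℝ} (hμ : ∀ j, ∑ a, μ j a = 1) (i : κ) (v : α → ℝ) :
    ∑ F : κ → α, (∏ j, μ j (F j)) * v (F i) = ∑ a, μ i a * v a := by
  have h := Fintype.prod_sum fun j a => μ j a * if j = i then v a else 1
  have h₁ : ∀ F : κ → α, ∏ j, (μ j (F j) * if j = i then v (F j) else 1) =
      (∏ j, μ j (F j)) * v (F i) := fun F => by
    rw [Finset.prod_mul_distrib, Finset.prod_ite_eq' Finset.univ i fun j => v (F j)]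
    simp
  rw [← Finset.sum_congr rfl fun F _ => h₁ F, ← h, Finset.prod_eq_single i]
  · simp
  · intro j _ hj
    simp [hj, hμ]
  · simp

theorem superposeOp_mem_fPolPlus {k l : ℕ} (hk : 0 < k) (hl : 0 < l) {f : Op D k}
    (hf : f ∈ fPolPlus Γ k) {g : Fin k → Op D l} (hg : ∀ i, g i ∈ fPolPlus Γ l) :
    superposeOp f g ∈ fPolPlus Γ l := by
  obtain ⟨ω, hω, hωf⟩ := exists_law_of_mem_fPolPlus hk hf
  choose μ hμ hμg using fun i => exists_law_of_mem_fPolPlus hl (hg i)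
  have hk' : (k : ℝ) ≠ 0 := by exact_mod_cast hk.ne'
  have hsum : ∀ i, ∀ v : Op D l → ℝ,
      ∑ F : Fin k → Op D l, (∏ j, μ j (F j)) * v (F i) = ∑ a, μ i a * v a :=
    sum_prod_mul_eval fun j => (hμ j).sum_eq_one
  have h := IsFracFamily.bind (Γ := Γ) (ν := fun F : Fin k → Op D l => ∏ j, μ j (F j))
    (fun F => Finset.prod_nonneg fun j _ => (hμ j).nonneg _)
    (by simpa [(hμ _).sum_eq_one] using hsum ⟨0, hk⟩ fun _ => 1) (fun _ => hω) (F := id)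
    (fun ϱ hϱ xs hxs _ hF i => (hμ i).feas ϱ hϱ xs hxs _
      (((hμ i).nonneg _).lt_of_ne' (Finset.prod_ne_zero_iff.1 hF.ne' i (Finset.mem_univ i))))
    (fun ϱ hϱ xs hxs => by
      simp only [id, ← mul_div_assoc, Finset.mul_sum]
      rw [← Finset.sum_div, Finset.sum_comm]
      simp only [hsum _ fun a => realCost (ϱ.2 (appRows a xs))]
      rw [div_le_iff₀ (by positivity)]
      refine (Finset.sum_le_sum fun i _ => (hμ i).le ϱ hϱ xs hxs).trans (le_of_eq ?_)
      simp [mul_comm])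
  exact h.mem_fPolPlus (a := (g, f)) (mul_pos (Finset.prod_pos fun j _ => hμg j) hωf)

theorem comp_perm_mem_fPolPlus {m : ℕ} (hm : 0 < m) {f : Op D m} (hf : f ∈ fPolPlus Γ m)
    (σ : Equiv.Perm (Fin m)) : (fun x => f fun i => x (σ i)) ∈ fPolPlus Γ m :=
  superposeOp_mem_fPolPlus hm hm hf (g := fun i => proj D (σ i)) fun _ => Or.inl ⟨_, rfl⟩

/-- The idempotent operations lying in `fPol⁺` of every language in `K`. -/
def idemClone (K : Set (VLang D)) (k : ℕ) : Set (Op D k) :=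
  {f | Idem f ∧ ∀ Γ ∈ K, f ∈ fPolPlus Γ k}

theorem isClone_idemClone [Nontrivial D] (K : Set (VLang D)) : IsClone (idemClone K) where
  proj_mem k i := ⟨fun _ => rfl, fun Γ _ => Or.inl ⟨i, rfl⟩⟩
  superpose_mem k l f g hf hg := by
    have hk := Idem.arity_pos hf.1
    have hl := Idem.arity_pos (hg ⟨0, hk⟩).1
    refine ⟨fun x => ?_, fun Γ hΓ => superposeOp_mem_fPolPlus hk hl (hf.2 Γ hΓ)
      fun i => (hg i).2 Γ hΓ⟩
    simp only [superposeOp, (hg _).1 x]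
    exact hf.1 x

end Frac

theorem sum_fiberwise_mem {Ω α : Type} [Fintype Ω] [DecidableEq α] (w : Ω → ℝ) (F : Ω → α)
    (Z : Finset α) :
    ∑ f ∈ Z, ∑ a with F a = f, w a = ∑ a, if F a ∈ Z then w a else 0 := by
  simp only [Finset.sum_filter]
  rw [Finset.sum_comm]
  simp

section Compact

variable {D : Type} [Fintype D] [DecidableEq D] {Γ : VLang D}

theorem isCompact_laws (Γ : VLang D) (m : ℕ) :
    IsCompact {ω : Op D m → ℝ | IsFracFamily Γ ω id} := by
  refine (isCompact_stdSimplex ℝ (Op D m)).of_isClosed_subset ?_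
    fun ω hω => ⟨hω.nonneg, hω.sum_eq_one⟩
  have heq : {ω : Op D m → ℝ | IsFracFamily Γ ω id} = stdSimplex ℝ (Op D m) ∩
      ⋂ ϱ ∈ Γ, ⋂ xs : Fin m → Fin ϱ.1 → D, ⋂ _ : ∀ i, xs i ∈ Feas ϱ.2,
        {ω | (∀ f, appRows f xs ∉ Feas ϱ.2 → ω f ≤ 0) ∧
          ∑ f, ω f * realCost (ϱ.2 (appRows f xs)) ≤ (∑ i, realCost (ϱ.2 (xs i))) / m} := by
    ext ω
    simp only [Set.mem_inter_iff, Set.mem_iInter]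
    constructor
    · exact fun h => ⟨⟨h.nonneg, h.sum_eq_one⟩, fun ϱ hϱ xs hxs =>
        ⟨fun f hf => not_lt.1 fun hlt => hf (h.feas ϱ hϱ xs hxs f hlt), h.le ϱ hϱ xs hxs⟩⟩
    · exact fun h => ⟨h.1.1, h.1.2, fun ϱ hϱ xs hxs f hf => by
        by_contra hfx
        exact absurd ((h.2 ϱ hϱ xs hxs).1 f hfx) (not_le.2 hf),
        fun ϱ hϱ xs hxs => (h.2 ϱ hϱ xs hxs).2⟩
  rw [heq]
  refine (isCompact_stdSimplex ℝ (Op D m)).isClosed.inter (isClosed_biInter fun ϱ _ =>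
    isClosed_iInter fun xs => isClosed_iInter fun _ => ?_)
  rw [Set.ofPred_and, Set.ofPred_forall]
  refine (isClosed_iInter fun f => ?_).inter
    (isClosed_le (continuous_finsetSum _ fun f _ => by fun_prop) continuous_const)
  rw [Set.ofPred_forall]
  exact isClosed_iInter fun _ => isClosed_le (continuous_apply f) continuous_const

/-- If each finite sublanguage has an `m`-ary fractional polymorphism supported on `Z`, then so
does the whole language. -/
theorem exists_law_of_finite_sublanguages {m : ℕ} (Z : Finset (Op D m))
    (h : ∀ Γ' ⊆ Γ, Γ'.Finite → ∃ ω : Op D m → ℝ, IsFracFamily Γ' ω id ∧ ∑ f ∈ Z, ω f = 1) :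
    ∃ ω : Op D m → ℝ, IsFracFamily Γ ω id ∧ ∑ f ∈ Z, ω f = 1 := by
  have hclosed : IsClosed {ω : Op D m → ℝ | ∑ f ∈ Z, ω f = 1} :=
    isClosed_eq (continuous_finsetSum _ fun f _ => continuous_apply f) continuous_const
  obtain ⟨ω, hω, hω'⟩ := ((isCompact_laws (∅ : VLang D) m).inter_right
    hclosed).inter_iInter_nonempty (fun ϱ : Γ => {ω : Op D m → ℝ | IsFracFamily {ϱ.1} ω id})
    (fun ϱ => (isCompact_laws _ m).isClosed) fun u => by
      obtain ⟨ω, hω, hωZ⟩ := h (Subtype.val '' (u : Set Γ)) (by simp)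
        (u.finite_toSet.image _)
      have hmono : ∀ Γ'' ⊆ Subtype.val '' (u : Set Γ), IsFracFamily Γ'' ω id := fun Γ'' hΓ =>
        ⟨hω.nonneg, hω.sum_eq_one, fun ϱ hϱ => hω.feas ϱ (hΓ hϱ), fun ϱ hϱ => hω.le ϱ (hΓ hϱ)⟩
      refine ⟨ω, ⟨hmono _ (Set.empty_subset _), hωZ⟩, Set.mem_iInter₂.2 fun ϱ hϱ => hmono _ ?_⟩
      rw [Set.singleton_subset_iff]
      exact ⟨ϱ, hϱ, rfl⟩
  have hω'' := fun ϱ hϱ => Set.mem_iInter.1 hω' ⟨ϱ, hϱ⟩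
  exact ⟨ω, ⟨hω.1.nonneg, hω.1.sum_eq_one, fun ϱ hϱ => (hω'' ϱ hϱ).feas ϱ rfl,
    fun ϱ hϱ => (hω'' ϱ hϱ).le ϱ rfl⟩, hω.2⟩

/-- If `Z` is closed under permuting coordinates and every operation outside `Z` is carried into
`Z` by substituting permutation minors into `t ∈ fPol⁺(Γ)`, then some fractional polymorphism is
supported on `Z`. -/
theorem exists_law_of_substitution {k M : ℕ} (hk : 0 < k) (hM : 0 < M) {t : Op D k}
    (ht : t ∈ fPolPlus Γ k) (Z : Finset (Op D M))
    (hZ : ∀ f ∈ Z, ∀ β : Equiv.Perm (Fin M), (fun x => f fun i => x (β i)) ∈ Z)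
    (α : Op D M → Fin k → Equiv.Perm (Fin M)) (hα : ∀ f ∈ Z, ∀ i, α f i = 1)
    (hαZ : ∀ f ∉ Z, (fun x => t fun i => f fun j => x (α f i j)) ∈ Z) :
    ∃ ω : Op D M → ℝ, IsFracFamily Γ ω id ∧ ∑ f ∈ Z, ω f = 1 := by
  classical
  obtain ⟨ω, hω, hωt⟩ := exists_law_of_mem_fPolPlus hk ht
  obtain ⟨μ, hμ, hmax⟩ := (isCompact_laws Γ M).exists_isMaxOn
    ⟨_, isFracFamily_projLaw Γ hM⟩
    (f := fun μ => ∑ f ∈ Z, μ f)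
    (continuous_finsetSum _ fun f _ => continuous_apply f).continuousOn
  replace hμ : IsFracFamily Γ μ id := hμ
  have hk' : (k : ℝ) ≠ 0 := by exact_mod_cast hk.ne'
  have hc : (0 : ℝ) < Fintype.card (Equiv.Perm (Fin M)) := by exact_mod_cast Fintype.card_pos
  set c : ℝ := ((Fintype.card (Equiv.Perm (Fin M)) : ℕ) : ℝ) with hcdef
  let W : Op D M × Equiv.Perm (Fin M) → Op D k → ℝ := fun ψ =>
    if ψ.1 ∈ Z then projLaw D k else ω
  have hW : ∀ ψ, IsFracFamily Γ (W ψ) id := fun ψ => by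
    by_cases hψ : ψ.1 ∈ Z
    · simpa only [W, if_pos hψ] using isFracFamily_projLaw Γ hk
    · simpa only [W, if_neg hψ] using hω
  let F : Op D M × Equiv.Perm (Fin M) → Fin k → Op D M := fun ψ i x =>
    ψ.1 fun j => x (ψ.2 (α ψ.1 i j))
  have hfam := IsFracFamily.bind (Γ := Γ) (ν := fun ψ : Op D M × Equiv.Perm (Fin M) => μ ψ.1 / c)
    (fun ψ => div_nonneg (hμ.nonneg _) hc.le)
    (by
      rw [Fintype.sum_prod_type]
      simp [← hcdef, mul_div_cancel₀ _ hc.ne', hμ.sum_eq_one]) hW (F := F)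
    (fun ϱ hϱ xs hxs ψ hψ i => hμ.feas ϱ hϱ (fun j => xs (ψ.2 (α ψ.1 i j))) (fun _ => hxs _) ψ.1
      ((div_pos_iff_of_pos_right hc).1 hψ))
    (fun ϱ hϱ xs hxs => by
      let v : Op D M → Equiv.Perm (Fin M) → ℝ := fun f β =>
        realCost (ϱ.2 (appRows f fun j => xs (β j)))
      have h₁ : ∀ f : Op D M, ∑ β, μ f / c * ((∑ i, v f (β * α f i)) / k) =
          ∑ β, μ f * v f β / c := by
        intro f
        have hshift : ∀ i, ∑ β, v f (β * α f i) = ∑ β, v f β := fun i =>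
          Equiv.sum_comp (Equiv.mulRight (α f i)) (v f)
        rw [← Finset.mul_sum, ← Finset.sum_div, Finset.sum_comm]
        simp only [hshift]
        rw [← Finset.sum_div, ← Finset.mul_sum]
        simp
        field_simp
      rw [Fintype.sum_prod_type]
      refine (Finset.sum_congr rfl fun f _ => h₁ f).trans_le ?_
      rw [Finset.sum_comm]
      have h₂ : ∀ β : Equiv.Perm (Fin M), ∑ f, μ f * v f β / c ≤
          (∑ i, realCost (ϱ.2 (xs i))) / M / c := by
        intro β
        rw [← Finset.sum_div]
        have h₃ := hμ.le ϱ hϱ (fun j => xs (β j)) fun _ => hxs _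
        rw [Equiv.sum_comp β fun j => realCost (ϱ.2 (xs j))] at h₃
        exact div_le_div_of_nonneg_right h₃ hc.le
      refine (Finset.sum_le_sum fun β _ => h₂ β).trans (le_of_eq ?_)
      simp [← hcdef, mul_div_cancel₀ _ hc.ne'])
  have hmass := hmax hfam.push
  have hlow : ∀ ψ : Op D M × Equiv.Perm (Fin M), μ ψ.1 / c * (if ψ.1 ∈ Z then 1 else ω t) ≤
      ∑ g, if superposeOp g (F ψ) ∈ Z then μ ψ.1 / c * W ψ g else 0 := by
    intro ψ
    have hν : 0 ≤ μ ψ.1 / c := div_nonneg (hμ.nonneg _) hc.le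
    by_cases hψ : ψ.1 ∈ Z
    · have hg : ∀ g, (if superposeOp g (F ψ) ∈ Z then μ ψ.1 / c * W ψ g else 0) =
          μ ψ.1 / c * W ψ g := by
        intro g
        by_cases hg : W ψ g = 0
        · simp [hg]
        · simp only [W, if_pos hψ] at hg
          obtain ⟨i, rfl⟩ := isProj_of_projLaw_pos hg
          refine if_pos ?_
          have heq : superposeOp (proj D i) (F ψ) = fun x => ψ.1 fun j => x (ψ.2 j) := by
            funext x
            simp [superposeOp, proj, F, hα _ hψ]
          rw [heq]
          exact hZ _ hψ ψ.2
      rw [Finset.sum_congr rfl fun g _ => hg g, ← Finset.mul_sum, (hW ψ).sum_eq_one, if_pos hψ]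
    · have hmem : superposeOp t (F ψ) ∈ Z := hZ _ (hαZ _ hψ) ψ.2
      refine le_trans (le_of_eq ?_) (Finset.single_le_sum (fun g _ => ?_) (Finset.mem_univ t))
      · simp only [if_pos hmem, if_neg hψ, W]
      · split_ifs
        · exact mul_nonneg hν ((hW ψ).nonneg g)
        · exact le_rfl
  have hlow' : ∑ f, μ f * (if f ∈ Z then 1 else ω t) ≤ ∑ f ∈ Z, μ f := by
    refine le_trans ?_ hmass
    calc ∑ f, μ f * (if f ∈ Z then 1 else ω t)
        = ∑ ψ : Op D M × Equiv.Perm (Fin M), μ ψ.1 / c * (if ψ.1 ∈ Z then 1 else ω t) := by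
          rw [Fintype.sum_prod_type]
          refine Finset.sum_congr rfl fun f _ => ?_
          show _ = ∑ _β : Equiv.Perm (Fin M), μ f / c * (if f ∈ Z then 1 else ω t)
          rw [Finset.sum_const, Finset.card_univ, nsmul_eq_mul, ← hcdef]
          field_simp
      _ ≤ ∑ ψ, ∑ g, if superposeOp g (F ψ) ∈ Z then μ ψ.1 / c * W ψ g else 0 :=
          Finset.sum_le_sum fun ψ _ => hlow ψ
      _ = _ := by
          refine Eq.trans ?_ (sum_fiberwise_mem _ _ Z).symm
          exact (Fintype.sum_prod_type fun a : (Op D M × Equiv.Perm (Fin M)) × Op D k =>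
            if superposeOp a.2 (F a.1) ∈ Z then μ a.1.1 / c * W a.1 a.2 else 0).symm
  refine ⟨μ, hμ, ?_⟩
  have hsplit := Finset.sum_add_sum_compl Z μ
  rw [hμ.sum_eq_one] at hsplit
  rw [← Finset.sum_add_sum_compl Z,
    Finset.sum_congr rfl fun f hf => by rw [if_pos hf, mul_one],
    Finset.sum_congr (s₁ := Zᶜ) rfl fun f hf => by rw [if_neg (Finset.mem_compl.1 hf)],
    ← Finset.sum_mul] at hlow'
  have h₀ : 0 ≤ ∑ f ∈ Zᶜ, μ f := Finset.sum_nonneg fun f _ => hμ.nonneg f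
  nlinarith

/-- Some member of `fPol⁺(Γ)` stays in `fPol⁺(Γ)` when any of its permutation minors are
substituted into an operation that lies in `fPol⁺` of all finite sublanguages. -/
theorem exists_stable_substitution {k M : ℕ} (hk : 0 < k) (hM : 0 < M) {t : Op D k}
    (ht : ∀ Γ' ⊆ Γ, Γ'.Finite → t ∈ fPolPlus Γ' k) :
    ∃ f ∈ fPolPlus Γ M, ∀ α : Fin k → Equiv.Perm (Fin M),
      (fun x => t fun i => f fun j => x (α i j)) ∈ fPolPlus Γ M := by
  classical
  by_contra! hcon
  let Z : Finset (Op D M) := Finset.univ.filter (· ∉ fPolPlus Γ M)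
  have hmemZ : ∀ f, f ∈ Z ↔ f ∉ fPolPlus Γ M := fun f => by simp [Z]
  have hα : ∀ f : Op D M, ∃ α : Fin k → Equiv.Perm (Fin M), (f ∈ Z → ∀ i, α i = 1) ∧
      (f ∉ Z → (fun x => t fun i => f fun j => x (α i j)) ∈ Z) := by
    intro f
    by_cases hf : f ∈ Z
    · exact ⟨fun _ => 1, fun _ _ => rfl, fun h => absurd hf h⟩
    · obtain ⟨α, hα⟩ := hcon f (not_not.1 fun h => hf ((hmemZ f).2 h))
      exact ⟨α, fun h => absurd h hf, fun _ => (hmemZ _).2 hα⟩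
  choose α hα₁ hα₂ using hα
  obtain ⟨ω, hω, hωZ⟩ := exists_law_of_finite_sublanguages (Γ := Γ) Z fun Γ' hΓ' hfin =>
    exists_law_of_substitution hk hM (ht Γ' hΓ' hfin) Z
      (fun f hf β => (hmemZ _).2 fun h => (hmemZ f).1 hf <| by
        simpa using comp_perm_mem_fPolPlus hM h β⁻¹) α hα₁ hα₂
  obtain ⟨f, hf, hf'⟩ := Finset.exists_ne_zero_of_sum_ne_zero
    (hωZ ▸ one_ne_zero : ∑ f ∈ Z, ω f ≠ 0)
  exact (hmemZ f).1 hf (hω.mem_fPolPlus ((hω.nonneg f).lt_of_ne' hf'))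

end Compact

/-! ### Taylor operations of finite sublanguages and of the whole language -/

theorem two_le_card_cube {D : Type} [Fintype D] [Nontrivial D] : 2 ≤ Fintype.card (D × D × D) :=
  Fintype.one_lt_card

section Taylor

variable {D : Type} [Fintype D] [DecidableEq D] {Γ : VLang D}

/-- If each finite sublanguage has a Taylor operation, they have a common one. -/
theorem exists_common_isTaylor [Nontrivial D]
    (h : ∀ Γ' ⊆ Γ, Γ'.Finite → ∃ (k : ℕ) (t : Op D k), t ∈ fPolPlus Γ' k ∧ IsTaylor t) :
    ∃ (k : ℕ) (t : Op D k), IsTaylor t ∧ ∀ Γ' ⊆ Γ, Γ'.Finite → t ∈ fPolPlus Γ' k := by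
  by_contra! hno
  let K : Set (VLang D) := {Γ' | Γ' ⊆ Γ ∧ Γ'.Finite}
  obtain ⟨B, χ, hB, hact⟩ := exists_splits_of_arity (isClone_idemClone K) (fun _ _ hf => hf.1)
    (fun k t ht hT => by
      obtain ⟨Γ', hΓ', hfin, htΓ'⟩ := hno k t hT
      exact htΓ' (ht.2 Γ' ⟨hΓ', hfin⟩)) (two_le_card_cube (D := D))
  have hwit : ∀ f : Op D (Fintype.card (D × D × D)), ∃ Γ' ∈ K,
      f ∈ fPolPlus Γ' _ → ∀ Γ'' ∈ K, f ∈ fPolPlus Γ'' _ := by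
    intro f
    by_cases hf : ∀ Γ'' ∈ K, f ∈ fPolPlus Γ'' _
    · exact ⟨∅, ⟨Set.empty_subset _, Set.finite_empty⟩, fun _ => hf⟩
    · obtain ⟨Γ', hΓ', hfΓ'⟩ := not_forall₂.1 hf
      exact ⟨Γ', hΓ', fun h => absurd h hfΓ'⟩
  choose Δ hΔK hΔ using hwit
  obtain ⟨k, t, ht, hT⟩ := h (⋃ f, Δ f) (Set.iUnion_subset fun f => (hΔK f).1)
    (Set.finite_iUnion fun f => (hΔK f).2)
  refine not_isTaylor_of_actsAsProj hB (actsAsProj_of_arity_card_cube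
    (isClone_idemClone {⋃ f, Δ f}) hB (fun f hf => hact f ⟨hf.1, ?_⟩)
    (⟨hT.1, by rintro _ rfl; exact ht⟩ : t ∈ idemClone {⋃ f, Δ f} k)) hT
  exact hΔ f (fPolPlus_anti (Set.subset_iUnion Δ f) _ (hf.2 _ rfl))

/-- In a core language, the unary part of a member of `fPol⁺(Γ)` can be inverted by composing
with unary members of `fPol⁺(Γ)`. -/
theorem exists_unary_inverse (hcore : ∀ f ∈ fPolPlus Γ 1, Function.Bijective (unaryFun f))
    {m : ℕ} (hm : 0 < m) {f : Op D m} (hf : f ∈ fPolPlus Γ m) :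
    ∃ v : D → D, (∀ d, v (f fun _ => d) = d) ∧
      ∀ g ∈ fPolPlus Γ m, (fun x => v (g x)) ∈ fPolPlus Γ m := by
  have hu : (fun x : Fin 1 → D => f fun _ => x 0) ∈ fPolPlus Γ 1 :=
    superposeOp_mem_fPolPlus hm one_pos hf (g := fun _ => proj D 0) fun _ => Or.inl ⟨_, rfl⟩
  let σ : Equiv.Perm D := Equiv.ofBijective _ (hcore _ hu)
  have hσ : ∀ d, σ d = f fun _ => d := fun _ => rfl
  have hmem : ∀ n : ℕ, ∀ g ∈ fPolPlus Γ m, (fun x => (σ ^ n) (g x)) ∈ fPolPlus Γ m := by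
    intro n g hg
    induction n with
    | zero => simpa using hg
    | succ n ih =>
      have h := superposeOp_mem_fPolPlus one_pos hm hu (g := fun _ x => (σ ^ n) (g x)) fun _ => ih
      simp only [pow_succ', Equiv.Perm.mul_apply, hσ]
      exact h
  refine ⟨⇑(σ ^ (orderOf σ - 1)), fun d => ?_, hmem _⟩
  rw [← hσ, ← Equiv.Perm.mul_apply, pow_sub_one_mul (orderOf_pos σ).ne', pow_orderOf_eq_one]
  rfl

/-- If idempotent members of `fPol⁺(Γ)` act as projections, there is an operation acting as a
given projection up to a unary map, such that its permutation minors substituted into `t` act as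
projections up to the same unary map. -/
theorem exists_stable_actsAsProj (hcore : ∀ f ∈ fPolPlus Γ 1, Function.Bijective (unaryFun f))
    {B : Set D} {χ : D → Prop} (hact : ∀ m, ∀ f ∈ idemClone {Γ} m, ActsAsProj B χ f)
    {k : ℕ} (hk : 0 < k) {t : Op D k} (hid : Idem t)
    (ht : ∀ Γ' ⊆ Γ, Γ'.Finite → t ∈ fPolPlus Γ' k) {ι : Type} [Fintype ι] (i₀ : ι) :
    ∃ (F : (ι → D) → D) (v : D → D),
      (∀ b : ι → D, (∀ i, b i ∈ B) → (χ (v (F b)) ↔ χ (b i₀))) ∧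
      ∀ α : Fin k → Equiv.Perm ι, ActsAsProj B χ fun x => v (t fun i => F fun j => x (α i j)) := by
  classical
  have hM : 0 < Fintype.card ι := Fintype.card_pos_iff.2 ⟨i₀⟩
  obtain ⟨f, hf, hstable⟩ := exists_stable_substitution hk hM ht
  obtain ⟨v, hv, hvmem⟩ := exists_unary_inverse hcore hM hf
  obtain ⟨l, hl⟩ := hact _ (fun x => v (f x)) ⟨hv, by rintro _ rfl; exact hvmem f hf⟩
  let e : ι ≃ Fin (Fintype.card ι) :=
    (Fintype.equivFin ι).trans (Equiv.swap (Fintype.equivFin ι i₀) l)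
  have he : e.symm l = i₀ := by simp [e]
  refine ⟨fun x => f fun j => x (e.symm j), v, fun b hb => ?_, fun α => ?_⟩
  · rw [← he]
    exact (hl _ fun _ => hb _).2
  · have hα := hstable fun i => e.symm.trans ((α i).trans e)
    obtain ⟨j, hj⟩ := hact _ (fun x => v (t fun i => f fun j => x (e (α i (e.symm j)))))
      ⟨fun d => (congrArg v (hid _)).trans (hv d), by rintro _ rfl; exact hvmem _ hα⟩
    refine ⟨e.symm j, fun b hb => ?_⟩
    simpa using hj (fun j => b (e.symm j)) fun _ => hb _

end Taylor

/-- The pattern indexed by two distinguished points and the pairs `(q, n)`, taking opposite values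
at the distinguished points, and value one at `(q, n)` exactly if `w q = n`. -/
def pattern {k N : ℕ} (s : Fin 2) (w : Fin k → Fin N) : Option (Option (Fin k × Fin N)) → Fin 2
  | none => s
  | some none => 1 - s
  | some (some p) => if w p.1 = p.2 then 1 else 0

/-- The permutation exchanging the distinguished points with two points of the `i`-th column. -/
def columnSwap {k N : ℕ} (P : Fin k → Fin 2 → Fin N) (i : Fin k) :
    Equiv.Perm (Option (Option (Fin k × Fin N))) :=
  Equiv.swap none (some (some (i, P i 1))) * Equiv.swap (some none) (some (some (i, P i 0)))

theorem pattern_columnSwap {k N : ℕ} {P : Fin k → Fin 2 → Fin N} (hP : ∀ q, P q 0 ≠ P q 1)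
    (s : Fin 2) (A : Fin k → Fin 2) (i : Fin k) (j : Option (Option (Fin k × Fin N))) :
    pattern s (fun q => P q (A q)) (columnSwap P i j) =
      pattern (A i) (fun q => P q (if q = i then s else A q)) j := by
  have h01 := hP i
  have h10 := (hP i).symm
  have hval : ∀ r r' : Fin 2, P i r = P i r' ↔ r = r' := by
    intro r r'
    fin_cases r <;> fin_cases r' <;> simp [h01, h10]
  have hbit : ∀ r : Fin 2, (if r = 1 then (1 : Fin 2) else 0) = r ∧
      (if r = 0 then (1 : Fin 2) else 0) = 1 - r := by decide
  rcases j with _ | _ | ⟨q, n⟩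
  · have h : columnSwap P i none = some (some (i, P i 1)) := by
      simp [columnSwap, Equiv.swap_apply_of_ne_of_ne]
    simp only [h, pattern, hval, hbit]
  · have h : columnSwap P i (some none) = some (some (i, P i 0)) := by
      simp [columnSwap, Equiv.swap_apply_of_ne_of_ne, h01]
    simp only [h, pattern, hval, hbit]
  · by_cases hq : q = i
    · subst hq
      by_cases h1 : n = P q 1
      · subst h1
        have h : columnSwap P q (some (some (q, P q 1))) = none := by
          simp [columnSwap, Equiv.swap_apply_of_ne_of_ne, h10]
        simp only [h, pattern, if_true, hval, hbit]
      · by_cases h0 : n = P q 0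
        · subst h0
          have h : columnSwap P q (some (some (q, P q 0))) = some none := by
            simp [columnSwap, Equiv.swap_apply_of_ne_of_ne]
          simp only [h, pattern, if_true, hval, hbit]
        · have h : columnSwap P q (some (some (q, n))) = some (some (q, n)) := by
            simp [columnSwap, Equiv.swap_apply_of_ne_of_ne, h0, h1]
          have hne : ∀ r : Fin 2, P q r ≠ n := by
            intro r
            fin_cases r
            · exact Ne.symm h0
            · exact Ne.symm h1
          simp only [h, pattern, hne, if_false]
    · have h : columnSwap P i (some (some (q, n))) = some (some (q, n)) := by
        simp [columnSwap, Equiv.swap_apply_of_ne_of_ne, hq]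
      simp only [h, pattern, hq, if_false]

/-- A Taylor operation cannot be compatible with permutation minors acting as projections. -/
theorem exists_not_actsAsProj_of_isTaylor {D : Type} [Finite D] {B : Set D} {χ : D → Prop}
    (hB : Splits B χ) {k : ℕ} {t : Op D k} (ht : IsTaylor t) :
    ∃ (ι : Type) (_ : Fintype ι) (i₀ : ι), ∀ (F : (ι → D) → D) (v : D → D),
      (∀ b : ι → D, (∀ i, b i ∈ B) → (χ (v (F b)) ↔ χ (b i₀))) →
      ∃ α : Fin k → Equiv.Perm ι,
        ¬ ActsAsProj B χ fun x => v (t fun i => F fun j => x (α i j)) := by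
  obtain ⟨⟨c₀, hc₀, hχ₀⟩, c₁, hc₁, hχ₁⟩ := hB
  obtain ⟨N, hN⟩ := exists_monochromatic_subbox (D × D) k
  refine ⟨Option (Option (Fin k × Fin N)), inferInstance, none, fun F v hF => ?_⟩
  let U : Fin 2 → D := ![c₀, c₁]
  have hU : ∀ s, U s ∈ B := by simp [U, Fin.forall_fin_two, hc₀, hc₁]
  have hχU : ∀ s, χ (U s) ↔ s = 1 := by simp [U, Fin.forall_fin_two, hχ₀, hχ₁]
  let G : Fin 2 → (Fin k → Fin N) → D := fun s w => F fun j => U (pattern s w j)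
  obtain ⟨P, hP, hmono⟩ := hN fun w => (G 0 w, G 1 w)
  obtain ⟨p, hp⟩ : ∃ p : Fin 2 → D, ∀ s (ε : Fin k → Fin 2), G s (fun q => P q (ε q)) = p s := by
    refine ⟨fun s => G s fun q => P q 0, Fin.forall_fin_two.2 ⟨fun ε => ?_, fun ε => ?_⟩⟩
    · exact congrArg Prod.fst (hmono ε fun _ => 0)
    · exact congrArg Prod.snd (hmono ε fun _ => 0)
  refine ⟨columnSwap P, ?_⟩
  rintro ⟨j, hj⟩
  have key : ∀ (s : Fin 2) (A : Fin k → Fin 2),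
      χ (v (t fun i => p (A i))) ↔ pattern s (fun q => P q (A q)) j = 1 := by
    intro s A
    have h := (hj (fun j => U (pattern s (fun q => P q (A q)) j)) fun _ => hU _).2
    simp only [pattern_columnSwap hP] at h
    rw [hχU] at h
    rw [← h]
    have harg : (fun i => p (A i)) = fun i => F fun j =>
        U (pattern (A i) (fun q => P q (if q = i then s else A q)) j) :=
      funext fun i => (hp (A i) fun q => if q = i then s else A q).symm
    rw [harg]
  rcases j with _ | _ | ⟨q, n⟩
  · exact absurd ((key 0 fun _ => 0).1 ((key 1 fun _ => 0).2 rfl)) (by simp [pattern])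
  · exact absurd ((key 1 fun _ => 0).1 ((key 0 fun _ => 0).2 rfl)) (by simp [pattern])
  · have key' : ∀ A : Fin k → Fin 2, χ (v (t fun i => p (A i))) ↔ P q (A q) = n := fun A => by
      rw [key 0 A]
      by_cases h : P q (A q) = n <;> simp [pattern, h]
    obtain ⟨a, b, ha, hb, hab⟩ := ht.2 q
    have h₁ : P q 1 = n := by
      rw [← key' fun _ => 1, ht.1, ← hp 1 fun _ => 0]
      exact (hF _ fun _ => hU _).2 ((hχU 1).2 rfl)
    have h₀ : P q 0 = n := by
      have h := (key' b).2 (by rw [hb, h₁])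
      rw [← hab p, key' a, ha] at h
      exact h
    exact hP q (h₀.trans h₁.symm)

end VCSP

/-- For a core language `Γ`, if every finite sublanguage has a Taylor
operation in its fractional positive clone, then so does `Γ`. -/
theorem taylor_fPolPlus_of_finite_sublanguages {D : Type} [Fintype D] [DecidableEq D]
    [Nonempty D] (Γ : VLang D)
    (hcore : ∀ f ∈ fPolPlus Γ 1, Function.Bijective (unaryFun f))
    (h : ∀ Γ' : VLang D, Γ' ⊆ Γ → Γ'.Finite →
      ∃ (k : ℕ) (t : Op D k), t ∈ fPolPlus Γ' k ∧ IsTaylor t) :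
    ∃ (k : ℕ) (t : Op D k), t ∈ fPolPlus Γ k ∧ IsTaylor t := by
  rcases subsingleton_or_nontrivial D with _ | _
  · exact ⟨1, proj D 0, Or.inl ⟨0, rfl⟩, fun _ => rfl, fun _ => ⟨fun _ => 0, fun _ => 1, rfl, rfl,
      fun _ => Subsingleton.elim _ _⟩⟩
  by_contra! hno
  have hC := VCSP.isClone_idemClone {Γ}
  obtain ⟨B, χ, hB, hact⟩ := VCSP.exists_splits_of_arity hC (fun _ _ hf => hf.1)
    (fun k t ht => hno k t (ht.2 Γ rfl)) (VCSP.two_le_card_cube (D := D))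
  obtain ⟨k, t, hT, ht⟩ := VCSP.exists_common_isTaylor h
  obtain ⟨ι, _, i₀, hι⟩ := VCSP.exists_not_actsAsProj_of_isTaylor hB hT
  obtain ⟨F, v, hF, hα⟩ := VCSP.exists_stable_actsAsProj hcore
    (fun m f hf => VCSP.actsAsProj_of_arity_card_cube hC hB hact hf)
    (VCSP.Idem.arity_pos hT.1) hT.1 ht i₀
  obtain ⟨α, hα'⟩ := hι F v hF
  exact hα' (hα α)
end
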